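/- arXiv:math/0002015 — 4 statements merged into one kernel-verified Lean document; each statement's English description precedes it below -/
import Mathlib

section
/- Suppose the Weyl group W of A is finite, let w_0 be its longest element and l_0 its length, and suppose the first l_0 terms i_{l_0}, …, i_1 of ι form a reduced word for w_0 (i.e. w_0 = s_{i_{l_0}}⋯s_{i_1} reduced). Then every x ∈ F(λ) satisfies x_k = 0 for all k > l_0; consequently x ↦ (x_{l_0}, …, x_2, x_1) is an injective map of F(λ) (the image of the crystal B(λ)) into the finite rank lattice ℤ^{l_0}. -/
noncomputable section

namespace PaperNakashima

variable {I : Type*} [DecidableEq I]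

/-- `σ_k(x) = x_k + Σ_{j>k} a_{i_k i_j} x_j`. -/
def sig (A : I → I → ℤ) (ι : ℕ → I) (k : ℕ) (x : ℕ →₀ ℤ) : ℤ :=
  x k + ∑ j ∈ x.support.filter (fun j => k < j), A (ι k) (ι j) * x j

/-- `σ_0^{(i)}(x) = -λ_i + Σ_{j≥1} a_{i i_j} x_j`. -/
def sig0 (A : I → I → ℤ) (ι : ℕ → I) (lam : I → ℤ) (i : I) (x : ℕ →₀ ℤ) : ℤ :=
  -lam i + ∑ j ∈ x.support.filter (fun j => 1 ≤ j), A i (ι j) * x j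

/-- `σ^{(i)}(x) = max_{k ≥ 1, i_k = i} σ_k(x)`. -/
def sigMax (A : I → I → ℤ) (ι : ℕ → I) (i : I) (x : ℕ →₀ ℤ) : ℤ :=
  sSup ((fun k => sig A ι k x) '' {k | 1 ≤ k ∧ ι k = i})

/-- `M^{(i)}(x) = {k ≥ 1 : i_k = i, σ_k(x) = σ^{(i)}(x)}`. -/
def Mset (A : I → I → ℤ) (ι : ℕ → I) (i : I) (x : ℕ →₀ ℤ) : Set ℕ :=
  {k | 1 ≤ k ∧ ι k = i ∧ sig A ι k x = sigMax A ι i x}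

/-- The Kashiwara operator `f̃_i` on `ℤ^∞_ι[λ] ⊔ {0}`, with `none` playing the role of `0`. -/
def ftil (A : I → I → ℤ) (ι : ℕ → I) (lam : I → ℤ) (i : I) :
    Option (ℕ →₀ ℤ) → Option (ℕ →₀ ℤ)
  | none => none
  | some x =>
    if sig0 A ι lam i x < sigMax A ι i x then
      some (x + Finsupp.single (sInf (Mset A ι i x)) 1)
    else none

/-- The Kashiwara operator `ẽ_i` on `ℤ^∞_ι[λ] ⊔ {0}`. -/
def etil (A : I → I → ℤ) (ι : ℕ → I) (lam : I → ℤ) (i : I) :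
    Option (ℕ →₀ ℤ) → Option (ℕ →₀ ℤ)
  | none => none
  | some x =>
    if 0 < sigMax A ι i x ∧ sig0 A ι lam i x ≤ sigMax A ι i x then
      some (x - Finsupp.single (sSup (Mset A ι i x)) 1)
    else none

/-- `ε_i(x) = max(σ^{(i)}(x), σ_0^{(i)}(x))`. -/
def eps (A : I → I → ℤ) (ι : ℕ → I) (lam : I → ℤ) (i : I) (x : ℕ →₀ ℤ) : ℤ :=
  max (sigMax A ι i x) (sig0 A ι lam i x)

/-- `φ_i(x) = ε_i(x) - σ_0^{(i)}(x) = ⟨h_i, wt(x)⟩ + ε_i(x)`. -/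
def phi (A : I → I → ℤ) (ι : ℕ → I) (lam : I → ℤ) (i : I) (x : ℕ →₀ ℤ) : ℤ :=
  eps A ι lam i x - sig0 A ι lam i x

/-- `F(λ)`: the image of `B(λ)` under the Kashiwara embedding, i.e. all nonzero elements
obtained from the highest weight element `0̄` by applying Kashiwara operators `f̃`. -/
def FSet (A : I → I → ℤ) (ι : ℕ → I) (lam : I → ℤ) : Set (ℕ →₀ ℤ) :=
  {x | ∃ l : List I, List.foldl (fun y i => ftil A ι lam i y) (some 0) l = some x}

/-- The Demazure subsets `D_k`: `D_0 = {0̄}` and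
`D_k = { f̃_{i_k}^m(x) : m ≥ 0, x ∈ D_{k-1} } \ {0}`. -/
def Dem (A : I → I → ℤ) (ι : ℕ → I) (lam : I → ℤ) : ℕ → Set (ℕ →₀ ℤ)
  | 0 => {0}
  | (k+1) => {y | ∃ m : ℕ, ∃ x ∈ Dem A ι lam k,
      (ftil A ι lam (ι (k+1)))^[m] (some x) = some y}

/-- The Coxeter matrix entry attached to a generalized Cartan matrix:
`m_{ij} = 2, 3, 4, 6, ∞(=0)` according as `a_{ij} a_{ji} = 0, 1, 2, 3, ≥ 4`. -/
def coxEntry (A : I → I → ℤ) (i j : I) : ℕ :=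
  if i = j then 1
  else if A i j * A j i = 0 then 2
  else if A i j * A j i = 1 then 3
  else if A i j * A j i = 2 then 4
  else if A i j * A j i = 3 then 6
  else 0

/-- The Coxeter matrix of the Weyl group of a generalized Cartan matrix `A`. -/
def coxOf (A : I → I → ℤ) : CoxeterMatrix I where
  M := Matrix.of fun i j => coxEntry A i j
  isSymm := by
    ext i j
    by_cases h : i = j
    · simp [coxEntry, h]
    · simp only [Matrix.transpose_apply, Matrix.of_apply, coxEntry, if_neg h,
        if_neg (Ne.symm h), mul_comm (A i j) (A j i)]
  diagonal i := by simp [coxEntry]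
  off_diagonal i j h := by
    simp only [Matrix.of_apply, coxEntry, if_neg h]
    split_ifs <;> decide

/-- The word `i_L, i_{L-1}, …, i_1` (the first `L` letters of `ι`, read backwards). -/
def demWord (ι : ℕ → I) (L : ℕ) : List I :=
  (List.range L).map (fun k => ι (L - k))

/-! ### Crystals of finite words -/

section ListCrystal

variable {J : Type*}

/-- The value of the linear functional `g` on the content of `b`. -/
def content (g : J → ℤ) : List (J × ℤ) → ℤ
  | [] => 0
  | p :: b => g p.1 * p.2 + content g b

/-- `EpsGE A i b c` says that `ε_i(b) ≥ c`, where `b` is an element of the tensor product of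
the elementary crystals indexed by the letters of `b`. -/
def EpsGE (A : J → J → ℤ) (i : J) : List (J × ℤ) → ℤ → Prop
  | [], _ => False
  | p :: b, c => (p.1 = i ∧ c ≤ p.2) ∨ EpsGE A i b (c - A i p.1 * p.2)

open Classical in
/-- The operator `f̃_i` on a tensor product of elementary crystals. -/
def lower (A : J → J → ℤ) (i : J) : List (J × ℤ) → List (J × ℤ)
  | [] => []
  | p :: b =>
    if p.1 = i ∧ ¬ EpsGE A i b (p.2 - A i p.1 * p.2) then (p.1, p.2 + 1) :: b
    else p :: lower A i b

/-- Successive application of the operators `f̃_i` along a list of indices. -/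
def lowerSeq (A : J → J → ℤ) (w : List J) (b : List (J × ℤ)) : List (J × ℤ) :=
  w.foldl (fun y i => lower A i y) b

/-- Two elements are bisimilar when all sequences of operators `f̃` lead from them to elements
with the same contents and the same `ε`. -/
def Bisim (A : J → J → ℤ) (b b' : List (J × ℤ)) : Prop :=
  ∀ w : List J, (∀ g, content g (lowerSeq A w b) = content g (lowerSeq A w b')) ∧
    ∀ i c, EpsGE A i (lowerSeq A w b) c ↔ EpsGE A i (lowerSeq A w b') c

variable {A : J → J → ℤ}

theorem Bisim.refl (b : List (J × ℤ)) : Bisim A b b := fun _ => ⟨fun _ => rfl, fun _ _ => Iff.rfl⟩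

theorem Bisim.symm {b b' : List (J × ℤ)} (h : Bisim A b b') : Bisim A b' b :=
  fun w => ⟨fun g => ((h w).1 g).symm, fun i c => ((h w).2 i c).symm⟩

theorem Bisim.trans {b b' b'' : List (J × ℤ)} (h : Bisim A b b') (h' : Bisim A b' b'') :
    Bisim A b b'' :=
  fun w => ⟨fun g => ((h w).1 g).trans ((h' w).1 g), fun i c => ((h w).2 i c).trans ((h' w).2 i c)⟩

theorem Bisim.lower {b b' : List (J × ℤ)} (h : Bisim A b b') (i : J) :
    Bisim A (lower A i b) (lower A i b') :=
  fun w => h (i :: w)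

theorem Bisim.lowerSeq {b b' : List (J × ℤ)} (h : Bisim A b b') (w : List J) :
    Bisim A (lowerSeq A w b) (lowerSeq A w b') := by
  induction w generalizing b b' with
  | nil => exact h
  | cons i w ih => exact ih (h.lower i)

theorem Bisim.content_eq {b b' : List (J × ℤ)} (h : Bisim A b b') (g : J → ℤ) :
    content g b = content g b' := (h []).1 g

theorem Bisim.epsGE_iff {b b' : List (J × ℤ)} (h : Bisim A b b') (i : J) (c : ℤ) :
    EpsGE A i b c ↔ EpsGE A i b' c := (h []).2 i c

theorem Bisim.of_rel (R : List (J × ℤ) → List (J × ℤ) → Prop)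
    (h₁ : ∀ b b', R b b' → ∀ g, content g b = content g b')
    (h₂ : ∀ b b', R b b' → ∀ i c, EpsGE A i b c ↔ EpsGE A i b' c)
    (h₃ : ∀ b b', R b b' → ∀ i, R (PaperNakashima.lower A i b) (PaperNakashima.lower A i b'))
    {b b' : List (J × ℤ)} (h : R b b') : Bisim A b b' := by
  intro w
  induction w generalizing b b' with
  | nil => exact ⟨h₁ _ _ h, h₂ _ _ h⟩
  | cons i w ih => exact ih (h₃ _ _ h i)

theorem EpsGE.mono {i : J} {b : List (J × ℤ)} {c d : ℤ} (h : EpsGE A i b c) (hd : d ≤ c) :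
    EpsGE A i b d := by
  induction b generalizing c d with
  | nil => exact h
  | cons p b ih =>
    rcases h with h | h
    · exact Or.inl ⟨h.1, hd.trans h.2⟩
    · exact Or.inr (ih h (by omega))

theorem content_append (g : J → ℤ) (b₁ b₂ : List (J × ℤ)) :
    content g (b₁ ++ b₂) = content g b₁ + content g b₂ := by
  induction b₁ with
  | nil => simp [content]
  | cons p b ih => simp [content, ih, add_assoc]

theorem epsGE_append (i : J) (b₁ b₂ : List (J × ℤ)) (c : ℤ) :
    EpsGE A i (b₁ ++ b₂) c ↔ EpsGE A i b₁ c ∨ EpsGE A i b₂ (c - content (A i) b₁) := by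
  induction b₁ generalizing c with
  | nil => simp [EpsGE, content]
  | cons p b ih => simp [EpsGE, content, ih, or_assoc, sub_sub]

open Classical in
theorem lower_append (i : J) (b₁ b₂ : List (J × ℤ)) :
    lower A i (b₁ ++ b₂) =
      if ∀ c, EpsGE A i b₁ c → EpsGE A i b₂ (c - content (A i) b₁) then b₁ ++ lower A i b₂
      else lower A i b₁ ++ b₂ := by
  induction b₁ with
  | nil => simp [EpsGE]
  | cons p b ih =>
    have hC : (∀ c, EpsGE A i (p :: b) c → EpsGE A i b₂ (c - content (A i) (p :: b))) ↔
        (p.1 = i → EpsGE A i b₂ (p.2 - A i p.1 * p.2 - content (A i) b)) ∧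
          ∀ c, EpsGE A i b c → EpsGE A i b₂ (c - content (A i) b) := by
      constructor
      · intro h
        refine ⟨fun hp => ?_, fun c hc => ?_⟩
        · have := h p.2 (Or.inl ⟨hp, le_rfl⟩)
          simpa [content, sub_sub] using this
        · have := h (c + A i p.1 * p.2) (Or.inr (by simpa using hc))
          exact this.mono (by simp only [content]; omega)
      · rintro ⟨h₁, h₂⟩ c (⟨hp, hc⟩ | hc)
        · exact (h₁ hp).mono (by simp only [content]; omega)
        · exact (h₂ _ hc).mono (by simp only [content]; omega)
    rw [List.cons_append, lower, lower, ih, hC, epsGE_append]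
    by_cases hp : p.1 = i
    · by_cases h₂ : EpsGE A i b₂ (p.2 - A i p.1 * p.2 - content (A i) b)
      · by_cases hb : ∀ c, EpsGE A i b c → EpsGE A i b₂ (c - content (A i) b)
        · subst hp
          simp [h₂, if_pos hb]
        · have h₁ : EpsGE A i b (p.2 - A i p.1 * p.2) := by
            push Not at hb
            obtain ⟨c, hc, hc'⟩ := hb
            refine hc.mono ?_
            by_contra hlt
            exact hc' (h₂.mono (by omega))
          simp [h₁, hb]
      · by_cases h₁ : EpsGE A i b (p.2 - A i p.1 * p.2)
        · have hb : ¬ ∀ c, EpsGE A i b c → EpsGE A i b₂ (c - content (A i) b) :=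
            fun h => h₂ (h _ h₁)
          simp [h₁, hb]
        · subst hp
          simp [h₁, h₂]
    · simp only [hp, false_and, if_false, false_imp_iff, true_and]
      split_ifs <;> simp

theorem Bisim.append {b₁ b₁' b₂ b₂' : List (J × ℤ)} (h₁ : Bisim A b₁ b₁') (h₂ : Bisim A b₂ b₂') :
    Bisim A (b₁ ++ b₂) (b₁' ++ b₂') := by
  refine Bisim.of_rel (fun x y => ∃ x₁ x₂ y₁ y₂, x = x₁ ++ x₂ ∧ y = y₁ ++ y₂ ∧
    Bisim A x₁ y₁ ∧ Bisim A x₂ y₂) ?_ ?_ ?_ ⟨_, _, _, _, rfl, rfl, h₁, h₂⟩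
  · rintro _ _ ⟨x₁, x₂, y₁, y₂, rfl, rfl, h₁, h₂⟩ g
    rw [content_append, content_append, h₁.content_eq, h₂.content_eq]
  · rintro _ _ ⟨x₁, x₂, y₁, y₂, rfl, rfl, h₁, h₂⟩ i c
    rw [epsGE_append, epsGE_append, h₁.epsGE_iff, h₂.epsGE_iff, h₁.content_eq]
  · rintro _ _ ⟨x₁, x₂, y₁, y₂, rfl, rfl, h₁, h₂⟩ i
    have hC : (∀ c, EpsGE A i x₁ c → EpsGE A i x₂ (c - content (A i) x₁)) ↔
        ∀ c, EpsGE A i y₁ c → EpsGE A i y₂ (c - content (A i) y₁) :=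
      forall_congr' fun c => by rw [h₁.epsGE_iff, h₂.epsGE_iff, h₁.content_eq]
    rw [lower_append, lower_append, hC]
    split_ifs
    · exact ⟨_, _, _, _, rfl, rfl, h₁, h₂.lower i⟩
    · exact ⟨_, _, _, _, rfl, rfl, h₁.lower i, h₂⟩

theorem lower_eq_self {i : J} {b : List (J × ℤ)} (h : ∀ p ∈ b, p.1 ≠ i) : lower A i b = b := by
  induction b with
  | nil => rfl
  | cons p b ih =>
    simp only [List.mem_cons, forall_eq_or_imp] at h
    simp [lower, h.1, ih h.2]

theorem not_epsGE {i : J} {b : List (J × ℤ)} (h : ∀ p ∈ b, p.1 ≠ i) (c : ℤ) :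
    ¬ EpsGE A i b c := by
  induction b generalizing c with
  | nil => exact id
  | cons p b ih =>
    simp only [List.mem_cons, forall_eq_or_imp] at h
    simp [EpsGE, h.1, ih h.2]

theorem bisim_commute {i j : J} (hij : i ≠ j) (h : A i j = 0) (h' : A j i = 0) (a b : ℤ) :
    Bisim A [(i, a), (j, b)] [(j, b), (i, a)] := by
  refine Bisim.of_rel (fun x y => ∃ a b, x = [(i, a), (j, b)] ∧ y = [(j, b), (i, a)])
    ?_ ?_ ?_ ⟨a, b, rfl, rfl⟩
  · rintro _ _ ⟨a, b, rfl, rfl⟩ g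
    simp only [content]; ring
  · rintro _ _ ⟨a, b, rfl, rfl⟩ k c
    by_cases hi : i = k
    · subst hi; simp [EpsGE, hij.symm, h]
    · by_cases hj : j = k
      · subst hj; simp [EpsGE, hij, h']
      · simp [EpsGE, hi, hj]
  · rintro _ _ ⟨a, b, rfl, rfl⟩ k
    by_cases hi : i = k
    · subst hi; exact ⟨a + 1, b, by simp [lower, EpsGE, hij.symm]⟩
    · by_cases hj : j = k
      · subst hj; exact ⟨a, b + 1, by simp [lower, EpsGE, hij]⟩
      · exact ⟨a, b, by simp [lower, hi, hj]⟩

theorem bisim_braid {i j : J} (hij : i ≠ j) (hi : A i i = 2) (hj : A j j = 2)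
    (h : A i j = -1) (h' : A j i = -1) (a b c : ℤ) :
    Bisim A [(i, a), (j, b), (i, c)] [(j, min c (b - a)), (i, a + c), (j, max (b - c) a)] := by
  refine Bisim.of_rel (fun x y => ∃ a b c a' b' c' : ℤ, x = [(i, a), (j, b), (i, c)] ∧
    y = [(j, a'), (i, b'), (j, c')] ∧ a' = min c (b - a) ∧ b' = a + c ∧ c' = max (b - c) a)
    ?_ ?_ ?_ ⟨a, b, c, _, _, _, rfl, rfl, rfl, rfl, rfl⟩
  · rintro _ _ ⟨a, b, c, a', b', c', rfl, rfl, ha, hb, hc⟩ g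
    obtain rfl : c' = b - a' := by omega
    subst hb
    simp only [content]; ring
  · rintro _ _ ⟨a, b, c, a', b', c', rfl, rfl, ha, hb, hc⟩ k d
    by_cases hik : i = k
    · subst hik; simp [EpsGE, hij.symm, h, hi]; omega
    · by_cases hjk : j = k
      · subst hjk; simp [EpsGE, hij, h', hj]; omega
      · simp [EpsGE, hik, hjk]
  · rintro _ _ ⟨a, b, c, a', b', c', rfl, rfl, ha, hb, hc⟩ k
    by_cases hik : i = k
    · subst hik
      simp only [lower, EpsGE, hij.symm, hi, h]
      by_cases hcase : a - 2 * a + b ≤ c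
      · refine ⟨a, b, c + 1, a', b' + 1, c', ?_, ?_, ?_, ?_, ?_⟩
        · simp; omega
        · simp
        all_goals omega
      · refine ⟨a + 1, b, c, a', b' + 1, c', ?_, ?_, ?_, ?_, ?_⟩
        · simp; omega
        · simp
        all_goals omega
    · by_cases hjk : j = k
      · subst hjk
        simp only [lower, EpsGE, hij, hj, h']
        by_cases hcase : a' - 2 * a' + b' ≤ c'
        · refine ⟨a, b + 1, c, a', b', c' + 1, ?_, ?_, ?_, ?_, ?_⟩
          · simp
          · simp; omega
          all_goals omega
        · refine ⟨a, b + 1, c, a' + 1, b', c', ?_, ?_, ?_, ?_, ?_⟩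
          · simp
          · simp; omega
          all_goals omega
      · exact ⟨a, b, c, a', b', c', by simp [lower, hik, hjk], by simp [lower, hik, hjk],
          ha, hb, hc⟩

theorem map_fst_lower (i : J) (b : List (J × ℤ)) :
    (lower A i b).map Prod.fst = b.map Prod.fst := by
  induction b with
  | nil => rfl
  | cons p b ih =>
    rw [lower]
    split_ifs
    · rfl
    · simp [ih]

theorem epsGE_lower_of_eq_zero {i j : J} (hij : i ≠ j) (h : A i j = 0) (b : List (J × ℤ)) (c : ℤ) :
    EpsGE A i (lower A j b) c ↔ EpsGE A i b c := by
  induction b generalizing c with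
  | nil => rfl
  | cons p b ih =>
    rw [lower]
    split_ifs with hp
    · obtain ⟨rfl, -⟩ := hp
      simp [EpsGE, hij.symm, h]
    · simp [EpsGE, ih]

/-- The Cartan matrix of type `D₄`, with central node `3`. -/
def cartanD4 (a b : Fin 4) : ℤ := if a = b then 2 else if a = 3 ∨ b = 3 then -1 else 0

/-- Perform the commutation or the braid move of type `D₄` at position `p` of a word,
if there is one. -/
def moveD4 : ℕ → List (Fin 4) → List (Fin 4)
  | 0, a :: b :: r =>
    if a = b then a :: b :: r
    else if cartanD4 a b = 0 then b :: a :: r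
    else match r with
      | c :: r' => if c = a then b :: a :: b :: r' else a :: b :: c :: r'
      | [] => [a, b]
  | p + 1, a :: r => a :: moveD4 p r
  | _, r => r

/-- The zero element of the tensor product of elementary crystals indexed by a word. -/
def zeroWord (L : List J) : List (J × ℤ) := L.map fun a => (a, 0)

theorem zeroWord_append (L L' : List J) :
    zeroWord (L ++ L') = zeroWord L ++ zeroWord L' := List.map_append

theorem bisim_zeroWord_moveD4 (p : ℕ) (L : List (Fin 4)) :
    Bisim cartanD4 (zeroWord L) (zeroWord (moveD4 p L)) := by
  induction p generalizing L with
  | zero =>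
    rcases L with _ | ⟨a, _ | ⟨b, r⟩⟩
    · exact Bisim.refl _
    · exact Bisim.refl _
    · simp only [moveD4]
      split_ifs with hab h0
      · exact Bisim.refl _
      · exact (bisim_commute hab h0 (by revert a b; decide) 0 0).append (Bisim.refl (zeroWord r))
      · rcases r with _ | ⟨c, r⟩
        · exact Bisim.refl _
        · dsimp only
          split_ifs with hc
          · subst hc
            exact (bisim_braid hab (by simp [cartanD4]) (by simp [cartanD4])
              (by revert c b; decide) (by revert c b; decide) 0 0 0).append
                (Bisim.refl (zeroWord r))
          · exact Bisim.refl _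
  | succ p ih =>
    rcases L with _ | ⟨a, r⟩
    · exact Bisim.refl _
    · exact (Bisim.refl [(a, 0)]).append (ih r)

theorem bisim_zeroWord_foldl_moveD4 (l : List ℕ) (L : List (Fin 4)) :
    Bisim cartanD4 (zeroWord L) (zeroWord (l.foldl (fun L p => moveD4 p L) L)) := by
  induction l generalizing L with
  | nil => exact Bisim.refl _
  | cons p l ih => exact (bisim_zeroWord_moveD4 p L).trans (ih _)

open Classical in
/-- Unfold a word in the letter `i` and another letter to type `D₄`: the letter `i` becomes the
list of leaves `l`, and the other letter becomes the central node. -/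
def unfoldD4 (l : List (Fin 4)) (i : J) : List (J × ℤ) → List (Fin 4 × ℤ)
  | [] => []
  | p :: b => (if p.1 = i then l.map fun n => (n, p.2) else [(3, p.2)]) ++ unfoldD4 l i b

section Unfold

variable {l : List (Fin 4)} {i j : J} (hl : l = [0, 1] ∨ l = [0, 1, 2]) (hij : i ≠ j)
  (hi : A i i = 2) (hj : A j j = 2) (h : A i j = -1) (h' : A j i = -l.length)
include hl hij

theorem content_unfoldD4 {b : List (J × ℤ)} (hb : ∀ a ∈ b.map Prod.fst, a = i ∨ a = j)
    (g : J → ℤ) : content ![g i, 0, 0, g j] (unfoldD4 l i b) = content g b := by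
  induction b with
  | nil => rfl
  | cons p b ih =>
    obtain ⟨a, x⟩ := p
    simp only [List.map_cons, List.mem_cons, forall_eq_or_imp] at hb
    replace ih := ih hb.2
    rcases hb with ⟨rfl | rfl, hb⟩
    · rcases hl with rfl | rfl <;> simp [unfoldD4, content, ← ih]
    · simp [unfoldD4, content, ← ih, hij.symm]

include hi h in
theorem epsGE_unfoldD4_leaf {b : List (J × ℤ)} (hb : ∀ a ∈ b.map Prod.fst, a = i ∨ a = j)
    {n : Fin 4} (hn : n ∈ l) (c : ℤ) :
    EpsGE cartanD4 n (unfoldD4 l i b) c ↔ EpsGE A i b c := by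
  induction b generalizing c with
  | nil => rfl
  | cons p b ih =>
    obtain ⟨a, x⟩ := p
    simp only [List.map_cons, List.mem_cons, forall_eq_or_imp] at hb
    replace ih := ih hb.2
    rcases hb with ⟨rfl | rfl, hb⟩
    · rcases hl with rfl | rfl <;> fin_cases hn <;>
        simp_all [unfoldD4, EpsGE, cartanD4]
    · rcases hl with rfl | rfl <;> fin_cases hn <;>
        simp_all [unfoldD4, EpsGE, cartanD4, hij.symm]

include hj h' in
theorem epsGE_unfoldD4_center {b : List (J × ℤ)} (hb : ∀ a ∈ b.map Prod.fst, a = i ∨ a = j)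
    (c : ℤ) : EpsGE cartanD4 3 (unfoldD4 l i b) c ↔ EpsGE A j b c := by
  induction b generalizing c with
  | nil => rfl
  | cons p b ih =>
    obtain ⟨a, x⟩ := p
    simp only [List.map_cons, List.mem_cons, forall_eq_or_imp] at hb
    replace ih := ih hb.2
    rcases hb with ⟨rfl | rfl, hb⟩
    · rcases hl with rfl | rfl
      · have : c + x + x = c + 2 * x := by ring
        simp_all [unfoldD4, EpsGE, cartanD4]
      · have : c + x + x + x = c + 3 * x := by ring
        simp_all [unfoldD4, EpsGE, cartanD4]
    · simp_all [unfoldD4, EpsGE, cartanD4, hij.symm]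

include hi h in
theorem unfoldD4_lower_leaf {b : List (J × ℤ)} (hb : ∀ a ∈ b.map Prod.fst, a = i ∨ a = j) :
    unfoldD4 l i (lower A i b) = lowerSeq cartanD4 l (unfoldD4 l i b) := by
  have h01 : ∀ b c, EpsGE cartanD4 1 (lower cartanD4 0 b) c ↔ EpsGE cartanD4 1 b c :=
    epsGE_lower_of_eq_zero (by decide) (by decide)
  have h02 : ∀ b c, EpsGE cartanD4 2 (lower cartanD4 0 b) c ↔ EpsGE cartanD4 2 b c :=
    epsGE_lower_of_eq_zero (by decide) (by decide)
  have h12 : ∀ b c, EpsGE cartanD4 2 (lower cartanD4 1 b) c ↔ EpsGE cartanD4 2 b c :=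
    epsGE_lower_of_eq_zero (by decide) (by decide)
  induction b with
  | nil => rcases hl with rfl | rfl <;> rfl
  | cons p b ih =>
    obtain ⟨a, x⟩ := p
    simp only [List.map_cons, List.mem_cons, forall_eq_or_imp] at hb
    have hE : ∀ n ∈ l, ∀ c, EpsGE cartanD4 n (unfoldD4 l i b) c ↔ EpsGE A i b c :=
      fun n hn c => epsGE_unfoldD4_leaf hl hij hi h hb.2 hn c
    specialize ih hb.2
    rcases hb with ⟨rfl | rfl, hb⟩
    · by_cases hcond : EpsGE A a b (x - 2 * x) <;> rcases hl with rfl | rfl <;>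
        simp_all [unfoldD4, lower, lowerSeq, EpsGE, cartanD4]
    · rcases hl with rfl | rfl <;>
        simp_all [unfoldD4, lower, lowerSeq, cartanD4, hij.symm]

include hj h' in
theorem unfoldD4_lower_center {b : List (J × ℤ)} (hb : ∀ a ∈ b.map Prod.fst, a = i ∨ a = j) :
    unfoldD4 l i (lower A j b) = lower cartanD4 3 (unfoldD4 l i b) := by
  induction b with
  | nil => rfl
  | cons p b ih =>
    obtain ⟨a, x⟩ := p
    simp only [List.map_cons, List.mem_cons, forall_eq_or_imp] at hb
    have hE := epsGE_unfoldD4_center hl hij hj h' hb.2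
    specialize ih hb.2
    rcases hb with ⟨rfl | rfl, hb⟩
    · rcases hl with rfl | rfl <;> simp_all [unfoldD4, lower, EpsGE, cartanD4]
    · by_cases hcond : EpsGE A a b (x - 2 * x) <;>
        simp_all [unfoldD4, lower, cartanD4, hij.symm]

include hi hj h h' in
theorem Bisim.of_unfoldD4 {b b' : List (J × ℤ)} (hb : ∀ a ∈ b.map Prod.fst, a = i ∨ a = j)
    (hb' : ∀ a ∈ b'.map Prod.fst, a = i ∨ a = j)
    (hbb' : Bisim cartanD4 (unfoldD4 l i b) (unfoldD4 l i b')) : Bisim A b b' := by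
  refine Bisim.of_rel (fun b b' => (∀ a ∈ b.map Prod.fst, a = i ∨ a = j) ∧
    (∀ a ∈ b'.map Prod.fst, a = i ∨ a = j) ∧
    Bisim cartanD4 (unfoldD4 l i b) (unfoldD4 l i b')) ?_ ?_ ?_ ⟨hb, hb', hbb'⟩
  · rintro b b' ⟨hb, hb', hbb'⟩ g
    rw [← content_unfoldD4 hl hij hb, ← content_unfoldD4 hl hij hb', hbb'.content_eq]
  · rintro b b' ⟨hb, hb', hbb'⟩ k c
    by_cases hik : i = k
    · subst hik
      have h0 : (0 : Fin 4) ∈ l := by rcases hl with rfl | rfl <;> simp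
      rw [← epsGE_unfoldD4_leaf hl hij hi h hb h0, ← epsGE_unfoldD4_leaf hl hij hi h hb' h0,
        hbb'.epsGE_iff]
    · by_cases hjk : j = k
      · subst hjk
        rw [← epsGE_unfoldD4_center hl hij hj h' hb, ← epsGE_unfoldD4_center hl hij hj h' hb',
          hbb'.epsGE_iff]
      · have hne : ∀ b : List (J × ℤ), (∀ a ∈ b.map Prod.fst, a = i ∨ a = j) →
            ∀ p ∈ b, p.1 ≠ k := by
          rintro b hb p hp rfl
          rcases hb p.1 (List.mem_map_of_mem hp) with h | h
          exacts [hik h.symm, hjk h.symm]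
        exact iff_of_false (not_epsGE (hne b hb) c) (not_epsGE (hne b' hb') c)
  · rintro b b' ⟨hb, hb', hbb'⟩ k
    refine ⟨by rwa [map_fst_lower], by rwa [map_fst_lower], ?_⟩
    by_cases hik : i = k
    · subst hik
      rw [unfoldD4_lower_leaf hl hij hi h hb, unfoldD4_lower_leaf hl hij hi h hb']
      exact hbb'.lowerSeq l
    · by_cases hjk : j = k
      · subst hjk
        rw [unfoldD4_lower_center hl hij hj h' hb, unfoldD4_lower_center hl hij hj h' hb']
        exact hbb'.lower 3
      · have hne : ∀ b : List (J × ℤ), (∀ a ∈ b.map Prod.fst, a = i ∨ a = j) →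
            ∀ p ∈ b, p.1 ≠ k := by
          rintro b hb p hp rfl
          rcases hb p.1 (List.mem_map_of_mem hp) with h | h
          exacts [hik h.symm, hjk h.symm]
        rwa [lower_eq_self (hne b hb), lower_eq_self (hne b' hb')]

end Unfold

theorem bisim_zeroWord_B2 {i j : J} (hij : i ≠ j) (hi : A i i = 2) (hj : A j j = 2)
    (h : A i j = -1) (h' : A j i = -2) :
    Bisim A (zeroWord [i, j, i, j]) (zeroWord [j, i, j, i]) := by
  refine Bisim.of_unfoldD4 (l := [0, 1]) (Or.inl rfl) hij hi hj h (by simpa using h')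
    (by simp [zeroWord]) (by simp [zeroWord]) ?_
  have key := bisim_zeroWord_foldl_moveD4 [0, 1, 3, 2, 0, 2, 1] [0, 1, 3, 0, 1, 3]
  simpa [zeroWord, unfoldD4, hij.symm, moveD4, cartanD4] using key

theorem bisim_zeroWord_G2 {i j : J} (hij : i ≠ j) (hi : A i i = 2) (hj : A j j = 2)
    (h : A i j = -1) (h' : A j i = -3) :
    Bisim A (zeroWord [i, j, i, j, i, j]) (zeroWord [j, i, j, i, j, i]) := by
  refine Bisim.of_unfoldD4 (l := [0, 1, 2]) (Or.inr rfl) hij hi hj h (by simpa using h')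
    (by simp [zeroWord]) (by simp [zeroWord]) ?_
  have key := bisim_zeroWord_foldl_moveD4 [4, 5, 4, 2, 6, 4, 3, 1, 3, 6, 5, 7, 9, 8, 6, 4, 3, 2,
    0, 6, 4, 2, 4, 8, 7, 5, 3, 5, 7, 6, 5] [0, 1, 2, 3, 0, 1, 2, 3, 0, 1, 2, 3]
  simpa [zeroWord, unfoldD4, hij.symm, moveD4, cartanD4] using key

end ListCrystal

/-! ### The exchange property and the theorem of Matsumoto -/

section Coxeter

open CoxeterSystem

variable {B W : Type*} [Group W] {M : CoxeterMatrix B} (cs : CoxeterSystem M W)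

/-- The alternating word `s t s t …` of length `n`. -/
def altWord (s t : B) : ℕ → List B
  | 0 => []
  | n + 1 => s :: altWord t s n

theorem length_altWord (s t : B) (n : ℕ) : (altWord s t n).length = n := by
  induction n generalizing s t with
  | zero => rfl
  | succ n ih => simp [altWord, ih]

theorem altWord_two_mul_succ (s t : B) (n : ℕ) :
    altWord s t (2 * (n + 1)) = altWord s t (2 * n) ++ [s, t] := by
  induction n with
  | zero => rfl
  | succ n ih =>
    change s :: t :: altWord s t (2 * (n + 1)) = s :: t :: altWord s t (2 * n) ++ [s, t]
    rw [ih]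
    rfl

theorem reverse_altWord_two_mul (s t : B) (n : ℕ) :
    (altWord s t (2 * n)).reverse = altWord t s (2 * n) := by
  induction n with
  | zero => rfl
  | succ n ih => rw [altWord_two_mul_succ, List.reverse_append, ih]; rfl

theorem reverse_alternatingWord (s t : B) (n : ℕ) :
    (alternatingWord s t n).reverse = altWord t s n := by
  induction n generalizing s t with
  | zero => rfl
  | succ n ih => simp [alternatingWord_succ, altWord, ih]

theorem wordProd_altWord_comm (s t : B) :
    cs.wordProd (altWord s t (M s t)) = cs.wordProd (altWord t s (M s t)) := by
  rw [← reverse_alternatingWord t s, ← reverse_alternatingWord s t, wordProd_reverse,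
    wordProd_reverse, inv_inj]
  have := cs.wordProd_braidWord_eq s t
  rw [braidWord, braidWord, M.symmetric t s] at this
  exact this.symm

theorem leftInvSeq_altWord (s t : B) (n : ℕ) :
    cs.leftInvSeq (altWord s t n) =
      (List.range n).map fun k => (cs.simple s * cs.simple t) ^ k * cs.simple s := by
  induction n generalizing s t with
  | zero => rfl
  | succ n ih =>
    rw [altWord, leftInvSeq, ih, List.range_succ_eq_map, List.map_cons, List.map_map, List.map_map]
    congr 1
    · simp
    · refine List.map_congr_left fun k hk => ?_
      clear hk
      simp only [Function.comp_apply, MulAut.conj_apply, inv_simple, Nat.succ_eq_add_one]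
      induction k with
      | zero => simp [mul_assoc]
      | succ k ih =>
        rw [pow_succ' _ (k + 1), mul_assoc _ (_ ^ (k + 1)) (cs.simple s), ← ih, pow_succ']
        simp only [mul_assoc]

open Classical in
/-- The action of a simple reflection on pairs consisting of a group element and a sign. -/
def signAction (i : B) : Function.End (W × ZMod 2) :=
  fun p => (cs.simple i * p.1 * cs.simple i, p.2 + if p.1 = cs.simple i then 1 else 0)

open Classical in
theorem prod_signAction (ω : List B) (p : W × ZMod 2) :
    (ω.map (signAction cs)).prod p =
      (cs.wordProd ω * p.1 * (cs.wordProd ω)⁻¹, p.2 + ((cs.rightInvSeq ω).count p.1 : ℕ)) := by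
  induction ω with
  | nil => simp; rfl
  | cons i ω ih =>
    rw [List.map_cons, List.prod_cons]
    change signAction cs i ((ω.map (signAction cs)).prod p) = _
    rw [ih]
    have hiff : cs.wordProd ω * p.1 * (cs.wordProd ω)⁻¹ = cs.simple i ↔
        (cs.wordProd ω)⁻¹ * cs.simple i * cs.wordProd ω = p.1 := by
      constructor
      · intro h; rw [← h]; group
      · intro h; rw [← h]; group
    simp only [signAction, rightInvSeq, wordProd_cons, List.count_cons, hiff, beq_iff_eq,
      mul_inv_rev, inv_simple, Prod.mk.injEq]
    refine ⟨by group, ?_⟩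
    push_cast
    split_ifs <;> simp [add_assoc]

theorem isLiftable_signAction : M.IsLiftable (signAction cs) := by
  classical
  intro i j
  have hpow : ∀ m : ℕ, (signAction cs i * signAction cs j) ^ m =
      ((altWord i j (2 * m)).map (signAction cs)).prod := by
    intro m
    induction m with
    | zero => rfl
    | succ m ih =>
      rw [pow_succ, ih, altWord_two_mul_succ]
      simp
  have hmul : ∀ m : ℕ, cs.wordProd (altWord i j (2 * m)) = (cs.simple i * cs.simple j) ^ m := by
    intro m
    induction m with
    | zero => simp [altWord]
    | succ m ih =>
      rw [pow_succ, ← ih, altWord_two_mul_succ]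
      simp [wordProd_append, wordProd_cons]
  rw [hpow]
  funext p
  rw [prod_signAction, hmul, simple_mul_simple_pow]
  have hcount : (cs.rightInvSeq (altWord i j (2 * M i j))).count p.1 =
      (cs.leftInvSeq (altWord j i (2 * M i j))).count p.1 := by
    rw [← reverse_altWord_two_mul, rightInvSeq_reverse, List.count_reverse]
  rw [hcount, leftInvSeq_altWord, two_mul, List.range_add, List.map_append, List.map_map,
    List.count_append]
  have hper : (fun k => (cs.simple j * cs.simple i) ^ k * cs.simple j) ∘ (fun x => M i j + x) =
      fun k => (cs.simple j * cs.simple i) ^ k * cs.simple j := by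
    funext k
    simp [pow_add]
  rw [hper, Nat.cast_add, CharTwo.add_self_eq_zero]
  simp
  rfl

theorem mem_rightInvSeq_of_isRightDescent {ω : List B} {i : B}
    (h : cs.IsRightDescent (cs.wordProd ω) i) : cs.simple i ∈ cs.rightInvSeq ω := by
  classical
  obtain ⟨ω', hω', hprod⟩ := cs.exists_isReduced (cs.wordProd ω * cs.simple i)
  have heq : cs.wordProd ω = cs.wordProd (ω'.concat i) := by
    rw [wordProd_concat, ← hprod]; simp
  let φ := cs.lift ⟨signAction cs, isLiftable_signAction cs⟩
  have hφ : ∀ ω, φ (cs.wordProd ω) = (ω.map (signAction cs)).prod := by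
    intro ω
    rw [wordProd, map_list_prod, List.map_map]
    congr 2
    funext k
    exact cs.lift_apply_simple _ k
  have hcount := congrArg Prod.snd (congrFun
    ((hφ ω).symm.trans ((congrArg φ heq).trans (hφ _))) (cs.simple i, 0))
  rw [prod_signAction, prod_signAction, rightInvSeq_concat] at hcount
  have hnot : cs.simple i ∉ (cs.rightInvSeq ω').map (MulAut.conj (cs.simple i)) := by
    intro hmem
    obtain ⟨t, ht, hti⟩ := List.mem_map.1 hmem
    have : t = cs.simple i := by
      apply (MulAut.conj (cs.simple i)).injective
      rw [hti]; simp
    subst this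
    have := (cs.isRightInversion_of_mem_rightInvSeq hω' ht).2
    rw [← hprod, simple_mul_simple_cancel_right] at this
    exact absurd this (not_lt.2 h.le)
  by_contra hmem
  simp only [List.concat_eq_append, List.count_append, List.count_eq_zero_of_not_mem hmem,
    List.count_eq_zero_of_not_mem hnot] at hcount
  simp at hcount

theorem mem_leftInvSeq_of_isLeftDescent {ω : List B} {i : B}
    (h : cs.IsLeftDescent (cs.wordProd ω) i) : cs.simple i ∈ cs.leftInvSeq ω := by
  rw [← isRightDescent_inv_iff, ← wordProd_reverse] at h
  simpa [rightInvSeq_reverse] using mem_rightInvSeq_of_isRightDescent cs h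

section Matsumoto

variable (hord : ∀ s t k, s ≠ t → (cs.simple s * cs.simple t) ^ k = 1 → M s t ∣ k)
include hord

theorem exists_altWord_append {s t : B} (hst : s ≠ t) {w : W} (hs : cs.IsLeftDescent w s)
    (ht : cs.IsLeftDescent w t) (n : ℕ) (hn : M s t = 0 ∨ n ≤ M s t) :
    ∃ a b r, (a = s ∧ b = t ∨ a = t ∧ b = s) ∧ cs.IsReduced (altWord a b n ++ r) ∧
      cs.wordProd (altWord a b n ++ r) = w := by
  induction n with
  | zero =>
    obtain ⟨r, hr, rfl⟩ := cs.exists_isReduced w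
    exact ⟨s, t, r, Or.inl ⟨rfl, rfl⟩, hr, rfl⟩
  | succ n ih =>
    obtain ⟨a, b, r, hab, hred, hw⟩ := ih (hn.imp_right (by omega))
    have hb : cs.IsLeftDescent w b := by rcases hab with ⟨-, rfl⟩ | ⟨-, rfl⟩ <;> assumption
    have hne : a ≠ b := by
      rcases hab with ⟨rfl, rfl⟩ | ⟨rfl, rfl⟩
      exacts [hst, hst.symm]
    have hM : M a b = M s t := by
      rcases hab with ⟨rfl, rfl⟩ | ⟨rfl, rfl⟩
      exacts [rfl, M.symmetric _ _]
    have hmem := mem_leftInvSeq_of_isLeftDescent cs (hw.symm ▸ hb)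
    obtain ⟨j, hj, hjb⟩ := List.mem_iff_getElem.1 hmem
    have hnj : n ≤ j := by
      by_contra hlt
      have hmem' : cs.simple b ∈ cs.leftInvSeq (altWord a b n) := by
        have htake : altWord a b n = (altWord a b n ++ r).take n := by
          rw [List.take_append_of_le_length (by rw [length_altWord]),
            List.take_of_length_le (by rw [length_altWord])]
        rw [htake, leftInvSeq_take, ← hjb, List.mem_iff_getElem]
        exact ⟨j, by rw [List.length_take]; omega, by simp⟩
      rw [leftInvSeq_altWord, List.mem_map] at hmem'
      obtain ⟨k, hk, hkb⟩ := hmem'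
      have hpow : (cs.simple a * cs.simple b) ^ (k + 1) = 1 := by
        rw [pow_succ, ← mul_assoc, hkb, simple_mul_simple_self]
      have hdvd := hord a b _ hne hpow
      rw [hM] at hdvd
      rw [List.mem_range] at hk
      rcases hn with hn | hn
      · rw [hn] at hdvd; simp at hdvd
      · have := Nat.le_of_dvd (by omega) hdvd
        omega
    have hdel := cs.getD_leftInvSeq_mul_wordProd (altWord a b n ++ r) j
    rw [List.getD_eq_getElem _ _ hj, hjb, List.eraseIdx_append_of_length_le
      (by rw [length_altWord]; exact hnj), length_altWord] at hdel
    rw [length_leftInvSeq, List.length_append, length_altWord] at hj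
    have hprod : cs.wordProd (altWord b a (n + 1) ++ r.eraseIdx (j - n)) = w := by
      rw [altWord, List.cons_append, wordProd_cons, ← hdel, simple_mul_simple_cancel_left, hw]
    refine ⟨b, a, r.eraseIdx (j - n), hab.symm.imp And.symm And.symm, ?_, hprod⟩
    have hlen := hred.eq
    rw [CoxeterSystem.IsReduced, hprod, ← hw, hlen]
    simp only [List.length_append, length_altWord, List.length_eraseIdx]
    split_ifs <;> omega

theorem rel_of_wordProd_eq {E : List B → List B → Prop} (hE : Equivalence E)
    (hcons : ∀ a L L', E L L' → E (a :: L) (a :: L'))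
    (hbraid : ∀ s t r, s ≠ t → M s t ≠ 0 →
      E (altWord s t (M s t) ++ r) (altWord t s (M s t) ++ r))
    {ω ω' : List B} (hω : cs.IsReduced ω) (hω' : cs.IsReduced ω')
    (h : cs.wordProd ω = cs.wordProd ω') : E ω ω' := by
  induction hn : ω.length generalizing ω ω' with
  | zero =>
    have hlen : ω'.length = 0 := by rw [← hω'.eq, ← h, hω.eq, hn]
    rw [List.length_eq_zero_iff.1 hn, List.length_eq_zero_iff.1 hlen]
    exact hE.refl _
  | succ n ih =>
    have head : ∀ a u v, cs.IsReduced (a :: u) → cs.IsReduced (a :: v) →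
        (a :: u).length = n + 1 → cs.wordProd (a :: u) = cs.wordProd (a :: v) →
        E (a :: u) (a :: v) := by
      intro a u v hu hv hlen huv
      rw [wordProd_cons, wordProd_cons, mul_right_inj] at huv
      exact hcons a u v (ih (hu.drop 1) (hv.drop 1) huv (by simpa using hlen))
    have hlen : ω'.length = n + 1 := by rw [← hω'.eq, ← h, hω.eq, hn]
    obtain ⟨s, u, rfl⟩ := List.exists_cons_of_length_eq_add_one hn
    obtain ⟨t, v, rfl⟩ := List.exists_cons_of_length_eq_add_one hlen
    by_cases hst : s = t
    · subst hst
      exact head s u v hω hω' hn h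
    have desc : ∀ a u, cs.IsReduced (a :: u) → cs.IsLeftDescent (cs.wordProd (a :: u)) a := by
      intro a u hu
      rw [IsLeftDescent, hu.eq, wordProd_cons, simple_mul_simple_cancel_left]
      exact (cs.length_wordProd_le u).trans_lt (by simp)
    have hs := desc s u hω
    have ht := desc t v hω'
    rw [← h] at ht
    have hM : M s t ≠ 0 := by
      intro hM
      obtain ⟨a, b, r, -, hred, hw⟩ := exists_altWord_append cs hord hst hs ht (n + 2) (Or.inl hM)
      have := hred.eq
      rw [hw, hω.eq, List.length_append, length_altWord, hn] at this
      omega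
    obtain ⟨r, hred, hw, hred', hw'⟩ : ∃ r,
        cs.IsReduced (altWord s t (M s t) ++ r) ∧
        cs.wordProd (altWord s t (M s t) ++ r) = cs.wordProd (s :: u) ∧
        cs.IsReduced (altWord t s (M s t) ++ r) ∧
        cs.wordProd (altWord t s (M s t) ++ r) = cs.wordProd (s :: u) := by
      obtain ⟨a, b, r, hab, hred, hw⟩ :=
        exists_altWord_append cs hord hst hs ht (M s t) (Or.inr le_rfl)
      have hcomm : cs.wordProd (altWord s t (M s t) ++ r) =
          cs.wordProd (altWord t s (M s t) ++ r) := by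
        rw [wordProd_append, wordProd_append, wordProd_altWord_comm]
      have hiff : cs.IsReduced (altWord s t (M s t) ++ r) ↔
          cs.IsReduced (altWord t s (M s t) ++ r) := by
        simp only [CoxeterSystem.IsReduced, hcomm, List.length_append, length_altWord]
      rcases hab with ⟨rfl, rfl⟩ | ⟨rfl, rfl⟩
      · exact ⟨r, hred, hw, hiff.1 hred, hcomm ▸ hw⟩
      · exact ⟨r, hiff.2 hred, hcomm ▸ hw, hred, hw⟩
    have hlenr : (altWord s t (M s t) ++ r).length = n + 1 := by
      rw [← hred.eq, hw, hω.eq, hn]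
    have hb := hbraid s t r hst hM
    obtain ⟨m, hm⟩ := Nat.exists_eq_succ_of_ne_zero hM
    rw [hm] at hred hw hred' hw' hlenr hb
    refine hE.trans (head s u _ hω hred hn hw.symm) (hE.trans hb ?_)
    refine head t _ v hred' hω' ?_ (hw'.trans h)
    rw [← hlenr]
    change (t :: altWord s t m ++ r).length = _
    simp [length_altWord]
    omega

end Matsumoto

end Coxeter

/-! ### The geometric representation -/

section Geometric

variable {A : I → I → ℤ}

/-- The action of a simple reflection on the weight lattice, in fundamental coordinates. -/
def reflect (A : I → I → ℤ) (i : I) : Function.End (I → ℤ) :=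
  fun v k => v k - v i * A k i

theorem end_mul_apply {α : Type*} (f g : Function.End α) (x : α) : (f * g) x = f (g x) := rfl

theorem end_one_apply {α : Type*} (x : α) : (1 : Function.End α) x = x := rfl

theorem cartan_pair_cases {i j : I} (hAoff : ∀ i j, i ≠ j → A i j ≤ 0)
    (hAzero : ∀ i j, A i j = 0 ↔ A j i = 0) (hij : i ≠ j) :
    (A i j = 0 ∧ A j i = 0 ∧ coxEntry A i j = 2) ∨
    (A i j = -1 ∧ A j i = -1 ∧ coxEntry A i j = 3) ∨
    (A i j = -1 ∧ A j i = -2 ∧ coxEntry A i j = 4) ∨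
    (A i j = -2 ∧ A j i = -1 ∧ coxEntry A i j = 4) ∨
    (A i j = -1 ∧ A j i = -3 ∧ coxEntry A i j = 6) ∨
    (A i j = -3 ∧ A j i = -1 ∧ coxEntry A i j = 6) ∨
    (A i j < 0 ∧ 4 ≤ A i j * A j i ∧ coxEntry A i j = 0) := by
  have ha := hAoff i j hij
  have hb := hAoff j i hij.symm
  have hz := hAzero i j
  rw [coxEntry, if_neg hij]
  generalize A i j = a at *
  generalize A j i = b at *
  rcases ha.eq_or_lt with rfl | ha'
  · simp [hz.1 rfl]
  have hb' : b < 0 := lt_of_le_of_ne hb fun h => ha'.ne (hz.2 h)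
  by_cases h4 : 4 ≤ a * b
  · right; right; right; right; right; right
    refine ⟨ha', h4, ?_⟩
    split_ifs <;> omega
  · have h1 : -3 ≤ a := by nlinarith
    have h2 : -3 ≤ b := by nlinarith
    interval_cases a <;> interval_cases b <;> simp at h4 ⊢

theorem isLiftable_reflect (hAdiag : ∀ i, A i i = 2) (hAoff : ∀ i j, i ≠ j → A i j ≤ 0)
    (hAzero : ∀ i j, A i j = 0 ↔ A j i = 0) : (coxOf A).IsLiftable (reflect A) := by
  intro i j
  change (reflect A i * reflect A j) ^ coxEntry A i j = 1
  funext v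
  rw [end_one_apply]
  have hstart : v = fun k => v k - 0 * A k i - 0 * A k j := by simp
  have hi : ∀ x y : ℤ, reflect A i (fun k => v k - x * A k i - y * A k j) =
      fun k => v k - (v i - x - A i j * y) * A k i - y * A k j := by
    intro x y
    funext k
    simp only [reflect, hAdiag]
    ring
  have hj : ∀ x y : ℤ, reflect A j (fun k => v k - x * A k i - y * A k j) =
      fun k => v k - x * A k i - (v j - A j i * x - y) * A k j := by
    intro x y
    funext k
    simp only [reflect, hAdiag]
    ring
  by_cases hij : i = j
  · subst hij
    simp only [coxEntry, if_true, pow_one, end_mul_apply]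
    funext k
    simp only [reflect, hAdiag]
    ring
  rcases cartan_pair_cases hAoff hAzero hij with
    ⟨ha, hb, hm⟩ | ⟨ha, hb, hm⟩ | ⟨ha, hb, hm⟩ | ⟨ha, hb, hm⟩ | ⟨ha, hb, hm⟩ | ⟨ha, hb, hm⟩ |
      ⟨-, -, hm⟩ <;> rw [hm]
  case inr.inr.inr.inr.inr.inr => rfl
  all_goals
    rw [ha] at hi
    rw [hb] at hj
    simp only [pow_succ, pow_zero, one_mul, end_mul_apply]
    conv_lhs => rw [hstart]
    simp only [hi, hj]
    funext k
    ring

theorem dvd_of_pow_eq_one (hAdiag : ∀ i, A i i = 2) (hAoff : ∀ i j, i ≠ j → A i j ≤ 0)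
    (hAzero : ∀ i j, A i j = 0 ↔ A j i = 0) (i j : I) (n : ℕ) (hij : i ≠ j)
    (h : ((coxOf A).toCoxeterSystem.simple i * (coxOf A).toCoxeterSystem.simple j) ^ n = 1) :
    coxOf A i j ∣ n := by
  let cs := (coxOf A).toCoxeterSystem
  let φ := cs.lift ⟨reflect A, isLiftable_reflect hAdiag hAoff hAzero⟩
  have hφ : ∀ k, φ ((cs.simple i * cs.simple j) ^ k) = (reflect A i * reflect A j) ^ k := by
    intro k
    rw [map_pow, map_mul, cs.lift_apply_simple, cs.lift_apply_simple]
  change coxEntry A i j ∣ n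
  set m := coxEntry A i j with hmdef
  have hmod : (cs.simple i * cs.simple j) ^ (n % m) = 1 := by
    have hm1 : (cs.simple i * cs.simple j) ^ m = 1 := cs.simple_mul_simple_pow i j
    have h' : (cs.simple i * cs.simple j) ^ (n % m + m * (n / m)) = 1 := by
      rw [Nat.mod_add_div]; exact h
    rwa [pow_add, pow_mul, hm1, one_pow, mul_one] at h'
  have hT := hφ (n % m)
  rw [hmod, map_one] at hT
  rw [Nat.dvd_iff_mod_eq_zero]
  have hiv : ∀ v : I → ℤ, reflect A i v i = -v i := fun v => by
    simp only [reflect, hAdiag]; ring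
  have hjv : ∀ v : I → ℤ, reflect A j v j = -v j := fun v => by
    simp only [reflect, hAdiag]; ring
  have hijv : ∀ v : I → ℤ, reflect A i v j = v j - v i * A j i := fun v => rfl
  have hjiv : ∀ v : I → ℤ, reflect A j v i = v i - v j * A i j := fun v => rfl
  have hT1 := congrFun (congrFun hT (Pi.single i 1)) i
  have hT2 := congrFun (congrFun hT (Pi.single i 1)) j
  rw [end_one_apply, Pi.single_eq_same] at hT1
  rw [end_one_apply, Pi.single_eq_of_ne hij.symm] at hT2
  by_contra hr0
  have hvi : (Pi.single i 1 : I → ℤ) i = 1 := Pi.single_eq_same _ _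
  have hvj : (Pi.single i 1 : I → ℤ) j = 0 := Pi.single_eq_of_ne hij.symm _
  have hlt : m ≠ 0 → n % m < m := fun hm => Nat.mod_lt _ (Nat.pos_of_ne_zero hm)
  rcases cartan_pair_cases hAoff hAzero hij with
    ⟨ha, hb, hm⟩ | ⟨ha, hb, hm⟩ | ⟨ha, hb, hm⟩ | ⟨ha, hb, hm⟩ | ⟨ha, hb, hm⟩ | ⟨ha, hb, hm⟩ |
      ⟨ha, hab, hm⟩
  case inr.inr.inr.inr.inr.inr =>
    have key : ∀ k, ((reflect A i * reflect A j) ^ (k + 1)) (Pi.single i 1) i < 0 ∧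
        0 ≤ 2 * ((reflect A i * reflect A j) ^ (k + 1)) (Pi.single i 1) i -
          A i j * ((reflect A i * reflect A j) ^ (k + 1)) (Pi.single i 1) j := by
      intro k
      induction k with
      | zero =>
        simp only [zero_add, pow_one, end_mul_apply, hiv, hjv, hijv, hjiv, hvi, hvj]
        constructor
        · norm_num
        · linarith
      | succ k ih =>
        rw [pow_succ']
        simp only [end_mul_apply, hiv, hjv, hijv, hjiv]
        generalize ((reflect A i * reflect A j) ^ (k + 1)) (Pi.single i 1) = w at ih
        obtain ⟨h1, h2⟩ := ih
        constructor
        · linarith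
        · nlinarith
    obtain ⟨k, hk⟩ := Nat.exists_eq_succ_of_ne_zero hr0
    have := (key k).1
    rw [← Nat.succ_eq_add_one, ← hk, ← hT1] at this
    omega
  all_goals
    have hlt' := hlt (by omega)
    obtain ⟨r, hr⟩ : ∃ r, r = n % m := ⟨_, rfl⟩
    rw [← hr] at hlt' hr0 hT1 hT2
    rw [hmdef, hm] at hlt'
    clear hr
    interval_cases r
    all_goals
      simp [pow_succ, end_mul_apply, end_one_apply, hiv, hjv, hijv, hjiv, ha, hb, hvj] at hT1 hT2 hr0

end Geometric

/-! ### Independence of the reduced word -/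

section ReducedWord

variable {A : I → I → ℤ}

theorem bisim_zeroWord_altWord (hAdiag : ∀ i, A i i = 2) (hAoff : ∀ i j, i ≠ j → A i j ≤ 0)
    (hAzero : ∀ i j, A i j = 0 ↔ A j i = 0) {i j : I} (hij : i ≠ j)
    (hM : coxEntry A i j ≠ 0) :
    Bisim A (zeroWord (altWord i j (coxEntry A i j))) (zeroWord (altWord j i (coxEntry A i j))) := by
  have hi := hAdiag i
  have hj := hAdiag j
  rcases cartan_pair_cases hAoff hAzero hij with
    ⟨ha, hb, hm⟩ | ⟨ha, hb, hm⟩ | ⟨ha, hb, hm⟩ | ⟨ha, hb, hm⟩ | ⟨ha, hb, hm⟩ | ⟨ha, hb, hm⟩ |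
      ⟨-, -, hm⟩ <;> rw [hm]
  · exact bisim_commute hij ha hb 0 0
  · exact bisim_braid hij hi hj ha hb 0 0 0
  · exact bisim_zeroWord_B2 hij hi hj ha hb
  · exact (bisim_zeroWord_B2 hij.symm hj hi hb ha).symm
  · exact bisim_zeroWord_G2 hij hi hj ha hb
  · exact (bisim_zeroWord_G2 hij.symm hj hi hb ha).symm
  · exact absurd hm hM

theorem bisim_zeroWord_of_wordProd_eq (hAdiag : ∀ i, A i i = 2)
    (hAoff : ∀ i j, i ≠ j → A i j ≤ 0) (hAzero : ∀ i j, A i j = 0 ↔ A j i = 0) {L L' : List I}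
    (hL : (coxOf A).toCoxeterSystem.IsReduced L) (hL' : (coxOf A).toCoxeterSystem.IsReduced L')
    (h : (coxOf A).toCoxeterSystem.wordProd L = (coxOf A).toCoxeterSystem.wordProd L') :
    Bisim A (zeroWord L) (zeroWord L') := by
  refine rel_of_wordProd_eq (coxOf A).toCoxeterSystem
    (fun s t k hst hk => dvd_of_pow_eq_one hAdiag hAoff hAzero s t k hst hk)
    (E := fun L L' => Bisim A (zeroWord L) (zeroWord L'))
    ⟨fun _ => Bisim.refl _, Bisim.symm, Bisim.trans⟩ ?_ ?_ hL hL' h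
  · intro a L L' h
    exact (Bisim.refl [(a, 0)]).append h
  · intro s t r hst hM
    rw [zeroWord_append, zeroWord_append]
    exact (bisim_zeroWord_altWord hAdiag hAoff hAzero hst hM).append (Bisim.refl _)

theorem nonneg_of_mem_lower {i : I} {b : List (I × ℤ)} (h : ∀ p ∈ b, 0 ≤ p.2) :
    ∀ p ∈ lower A i b, 0 ≤ p.2 := by
  induction b with
  | nil => exact h
  | cons q b ih =>
    rw [List.forall_mem_cons] at h
    rw [lower]
    split_ifs
    · rw [List.forall_mem_cons]
      exact ⟨by have := h.1; dsimp only; omega, h.2⟩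
    · rw [List.forall_mem_cons]
      exact ⟨h.1, ih h.2⟩

theorem epsGE_lowerSeq_cons {i : I} (L : List I) (w : List I) :
    EpsGE A i (lowerSeq A w (zeroWord (i :: L))) 0 := by
  have key : ∀ b : List (I × ℤ), (∀ p ∈ b, 0 ≤ p.2) → b.map Prod.fst = i :: L →
      EpsGE A i (lowerSeq A w b) 0 := by
    induction w with
    | nil =>
      rintro (_ | ⟨p, b⟩) hb hfst
      · simp at hfst
      · exact Or.inl ⟨(List.cons.inj hfst).1, hb p List.mem_cons_self⟩
    | cons k w ih =>
      intro b hb hfst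
      exact ih _ (nonneg_of_mem_lower hb) ((map_fst_lower k b).trans hfst)
  apply key
  · simp [zeroWord]
  · simp [zeroWord, Function.comp_def]

theorem epsGE_lowerSeq_longest (hAdiag : ∀ i, A i i = 2) (hAoff : ∀ i j, i ≠ j → A i j ≤ 0)
    (hAzero : ∀ i j, A i j = 0 ↔ A j i = 0) {w₀ : (coxOf A).Group}
    (hw₀ : ∀ w, (coxOf A).toCoxeterSystem.length w ≤ (coxOf A).toCoxeterSystem.length w₀)
    {L : List I} (hL : (coxOf A).toCoxeterSystem.IsReduced L)
    (hword : (coxOf A).toCoxeterSystem.wordProd L = w₀) (i : I) (w : List I) :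
    EpsGE A i (lowerSeq A w (zeroWord L)) 0 := by
  let cs := (coxOf A).toCoxeterSystem
  obtain ⟨L', hL', hprod⟩ := cs.exists_isReduced (cs.simple i * w₀)
  have hcons : cs.wordProd (i :: L') = w₀ := by
    rw [cs.wordProd_cons, ← hprod, cs.simple_mul_simple_cancel_left]
  have hlen : cs.length (cs.simple i * w₀) + 1 = cs.length w₀ := by
    refine (cs.length_simple_mul w₀ i).resolve_left fun h => ?_
    have := hw₀ (cs.simple i * w₀)
    change cs.length _ ≤ cs.length _ at this
    omega
  have hred : cs.IsReduced (i :: L') := by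
    rw [CoxeterSystem.IsReduced, hcons, ← hlen, hprod, hL'.eq, List.length_cons]
  have hbisim := bisim_zeroWord_of_wordProd_eq hAdiag hAoff hAzero hL hred (hword.trans hcons.symm)
  exact ((hbisim.lowerSeq w).epsGE_iff i 0).2 (epsGE_lowerSeq_cons L' w)

end ReducedWord

/-! ### Truncation of the polyhedral realization -/

section Truncation

variable {J : Type*} {A : J → J → ℤ} {ι : ℕ → J}

/-- The element `(x_N, …, x_1)` of the tensor product of elementary crystals given by `ι`. -/
def truncation (ι : ℕ → J) (x : ℕ →₀ ℤ) : ℕ → List (J × ℤ)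
  | 0 => []
  | N + 1 => (ι (N + 1), x (N + 1)) :: truncation ι x N

theorem truncation_zero (N : ℕ) : truncation ι 0 N = zeroWord (demWord ι N) := by
  induction N with
  | zero => rfl
  | succ N ih =>
    rw [truncation, ih, demWord, demWord, List.range_succ_eq_map]
    simp [zeroWord, Function.comp_def]

theorem truncation_congr {x y : ℕ →₀ ℤ} {N : ℕ} (h : ∀ k ≤ N, x k = y k) :
    truncation ι x N = truncation ι y N := by
  induction N with
  | zero => rfl
  | succ N ih =>
    rw [truncation, truncation, ih fun k hk => h k (by omega), h _ le_rfl]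

theorem epsGE_truncation (i : J) (x : ℕ →₀ ℤ) (N : ℕ) (c : ℤ) :
    EpsGE A i (truncation ι x N) c ↔ ∃ k, 1 ≤ k ∧ k ≤ N ∧ ι k = i ∧
      c ≤ x k + ∑ j ∈ Finset.Ioc k N, A i (ι j) * x j := by
  induction N generalizing c with
  | zero =>
    simp only [truncation, EpsGE, false_iff]
    rintro ⟨k, h1, h2, -⟩
    omega
  | succ N ih =>
    rw [truncation, EpsGE, ih]
    constructor
    · rintro (⟨h1, h2⟩ | ⟨k, h1, h2, h3, h4⟩)
      · exact ⟨N + 1, by omega, le_rfl, h1, by simpa using h2⟩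
      · exact ⟨k, h1, by omega, h3, by rw [Finset.sum_Ioc_succ_top h2]; linarith⟩
    · rintro ⟨k, h1, h2, h3, h4⟩
      rcases h2.eq_or_lt with rfl | h2
      · exact Or.inl ⟨h3, by simpa using h4⟩
      · rw [Finset.sum_Ioc_succ_top (by omega)] at h4
        exact Or.inr ⟨k, h1, by omega, h3, by dsimp only; linarith⟩

theorem lower_truncation {i : J} {x : ℕ →₀ ℤ} {m N : ℕ} (hm : 1 ≤ m) (hmN : m ≤ N) (hi : ι m = i)
    (hlt : ∀ k, 1 ≤ k → k < m → ι k = i → x k + ∑ j ∈ Finset.Ioc k N, A i (ι j) * x j <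
      x m + ∑ j ∈ Finset.Ioc m N, A i (ι j) * x j)
    (hle : ∀ k, m < k → k ≤ N → ι k = i → x k + ∑ j ∈ Finset.Ioc k N, A i (ι j) * x j ≤
      x m + ∑ j ∈ Finset.Ioc m N, A i (ι j) * x j) :
    lower A i (truncation ι x N) = truncation ι (x + Finsupp.single m 1) N := by
  induction N with
  | zero => omega
  | succ N ih =>
    rw [truncation, truncation, lower]
    rcases hmN.eq_or_lt with rfl | hmN
    · rw [if_pos]
      · rw [truncation_congr (y := x + Finsupp.single (N + 1) 1) (N := N)]
        · simp
        · intro k hk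
          rw [Finsupp.add_apply, Finsupp.single_eq_of_ne (by omega), add_zero]
      · refine ⟨hi, fun h => ?_⟩
        obtain ⟨k, h1, h2, h3, h4⟩ := (epsGE_truncation _ _ _ _).1 h
        have := hlt k h1 (by omega) h3
        rw [Finset.sum_Ioc_succ_top h2] at this
        simp only [Finset.Ioc_self, Finset.sum_empty] at this
        dsimp only at h4
        linarith
    · have hmN' : m ≤ N := by omega
      rw [if_neg, ih hmN']
      · rw [Finsupp.add_apply, Finsupp.single_eq_of_ne (by omega), add_zero]
      · intro k h1 h2 h3
        have := hlt k h1 h2 h3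
        rw [Finset.sum_Ioc_succ_top hmN', Finset.sum_Ioc_succ_top (by omega)] at this
        linarith
      · intro k h1 h2 h3
        have := hle k h1 (by omega) h3
        rw [Finset.sum_Ioc_succ_top hmN', Finset.sum_Ioc_succ_top (by omega)] at this
        linarith
      · rintro ⟨h1, h2⟩
        apply h2
        have := hle (N + 1) hmN le_rfl h1
        rw [Finset.sum_Ioc_succ_top hmN'] at this
        simp only [Finset.Ioc_self, Finset.sum_empty] at this
        exact (epsGE_truncation _ _ _ _).2 ⟨m, hm, hmN', hi, by dsimp only; linarith⟩

theorem sig_eq_sum_Ioc {x : ℕ →₀ ℤ} {N : ℕ} (hx : ∀ k, N < k → x k = 0) (k : ℕ) :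
    sig A ι k x = x k + ∑ j ∈ Finset.Ioc k N, A (ι k) (ι j) * x j := by
  rw [sig]
  congr 1
  refine Finset.sum_subset (fun j hj => ?_) fun j hj hj' => ?_
  · rw [Finset.mem_filter, Finsupp.mem_support_iff] at hj
    rw [Finset.mem_Ioc]
    exact ⟨hj.2, not_lt.1 fun h => hj.1 (hx j h)⟩
  · rw [Finset.mem_Ioc] at hj
    rw [Finset.mem_filter, Finsupp.mem_support_iff, not_and', not_not] at hj'
    rw [hj' hj.1, mul_zero]

theorem exists_ftil_eq {lam : J → ℤ} {i : J} {x y : ℕ →₀ ℤ} {N : ℕ}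
    (hx : ∀ k, N < k → x k = 0) (heps : EpsGE A i (truncation ι x N) 0)
    (h : ftil A ι lam i (some x) = some y) :
    ∃ m, 1 ≤ m ∧ m ≤ N ∧ y = x + Finsupp.single m 1 ∧
      lower A i (truncation ι x N) = truncation ι y N := by
  have hzero : ∀ k, N < k → sig A ι k x = 0 := by
    intro k hk
    rw [sig_eq_sum_Ioc hx, hx k hk, Finset.Ioc_eq_empty_of_le hk.le, Finset.sum_empty, add_zero]
  obtain ⟨k₀, h1, h2, h3, h4⟩ := (epsGE_truncation _ _ _ _).1 heps
  have hk₀ : 0 ≤ sig A ι k₀ x := by rwa [sig_eq_sum_Ioc hx, h3]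
  set S := (fun k => sig A ι k x) '' {k | 1 ≤ k ∧ ι k = i} with hS
  have hfin : S.Finite := by
    refine (((Set.finite_Iic N).image fun k => sig A ι k x).union (Set.finite_singleton 0)).subset ?_
    rintro _ ⟨k, -, rfl⟩
    rcases le_or_gt k N with hk | hk
    · exact Or.inl ⟨k, hk, rfl⟩
    · exact Or.inr (hzero k hk)
  have hle : ∀ k, 1 ≤ k → ι k = i → sig A ι k x ≤ sigMax A ι i x := fun k hk hki =>
    le_csSup hfin.bddAbove ⟨k, ⟨hk, hki⟩, rfl⟩
  have hSne : S.Nonempty := ⟨_, k₀, ⟨h1, h3⟩, rfl⟩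
  have hne : (Mset A ι i x).Nonempty := by
    obtain ⟨k, ⟨hk, hki⟩, hmax⟩ := Int.csSup_mem hSne hfin.bddAbove
    exact ⟨k, hk, hki, hmax⟩
  obtain ⟨hm1, hmi, hmax⟩ := Nat.sInf_mem hne
  have hmin : ∀ k ∈ Mset A ι i x, sInf (Mset A ι i x) ≤ k := fun k hk => Nat.sInf_le hk
  rw [ftil] at h
  split_ifs at h
  rw [Option.some_inj] at h
  generalize sInf (Mset A ι i x) = m at *
  have hmN : m ≤ N := by
    by_contra! hmN
    rw [hzero m hmN] at hmax
    exact absurd (hmin k₀ ⟨h1, h3, le_antisymm (hle k₀ h1 h3) (hmax ▸ hk₀)⟩) (by omega)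
  refine ⟨m, hm1, hmN, h.symm, ?_⟩
  have hsig : ∀ k, ι k = i →
      x k + ∑ j ∈ Finset.Ioc k N, A i (ι j) * x j = sig A ι k x := by
    rintro k rfl
    exact (sig_eq_sum_Ioc hx k).symm
  rw [← h]
  refine lower_truncation hm1 hmN hmi ?_ ?_
  · intro k hk hkm hki
    rw [hsig k hki, hsig m hmi, hmax]
    refine lt_of_le_of_ne (hle k hk hki) fun heq => ?_
    exact absurd (hmin k ⟨hk, hki, heq⟩) (by omega)
  · intro k hkm _ hki
    rw [hsig k hki, hsig m hmi, hmax]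
    exact hle k (by omega) hki

theorem FSet_induction {lam : J → ℤ} {N : ℕ}
    (heps : ∀ i w, EpsGE A i (lowerSeq A w (zeroWord (demWord ι N))) 0) {x : ℕ →₀ ℤ}
    (hx : x ∈ FSet A ι lam) : x 0 = 0 ∧ ∀ k, N < k → x k = 0 := by
  obtain ⟨l, hl⟩ := hx
  suffices h : (x 0 = 0 ∧ ∀ k, N < k → x k = 0) ∧
      ∃ w, truncation ι x N = lowerSeq A w (zeroWord (demWord ι N)) from h.1
  induction l using List.reverseRecOn generalizing x with
  | nil =>
    obtain rfl : 0 = x := Option.some_inj.1 hl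
    exact ⟨⟨rfl, fun _ _ => rfl⟩, [], truncation_zero N⟩
  | append_singleton l i ih =>
    rw [List.foldl_append, List.foldl_cons, List.foldl_nil] at hl
    rcases hprev : List.foldl (fun y i => ftil A ι lam i y) (some 0) l with _ | z
    · rw [hprev] at hl
      exact absurd hl (by simp [ftil])
    · rw [hprev] at hl
      obtain ⟨⟨hz0, hz⟩, w, hw⟩ := ih hprev
      obtain ⟨m, hm1, hmN, rfl, hlower⟩ := exists_ftil_eq hz (hw ▸ heps i w) hl
      refine ⟨⟨?_, fun k hk => ?_⟩, w ++ [i], ?_⟩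
      · rw [Finsupp.add_apply, hz0, Finsupp.single_eq_of_ne (by omega), add_zero]
      · rw [Finsupp.add_apply, hz k hk, Finsupp.single_eq_of_ne (by omega), add_zero]
      · rw [← hlower, hw, lowerSeq, lowerSeq, List.foldl_append]
        rfl

end Truncation

/-- Suppose the Weyl group `W` of `A` is finite, `w₀` is its longest element,
of length `l₀`, and the first `l₀` terms of `ι` (read backwards) form a reduced word for `w₀`.
Then every `x ∈ F(λ)` satisfies `x_k = 0` for `k > l₀`, and the truncation
`x ↦ (x_{l₀}, …, x_1)` embeds `F(λ)` into the finite rank lattice `ℤ^{l₀}`. -/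
theorem embedding_finite_rank {I : Type*} [Fintype I] [DecidableEq I]
    (A : I → I → ℤ)
    (hAdiag : ∀ i, A i i = 2)
    (hAoff : ∀ i j, i ≠ j → A i j ≤ 0)
    (hAzero : ∀ i j, A i j = 0 ↔ A j i = 0)
    (hAsym : ∃ d : I → ℤ, (∀ i, 0 < d i) ∧ ∀ i j, d i * A i j = d j * A j i)
    (ι : ℕ → I)
    (hι₁ : ∀ k, 1 ≤ k → ι k ≠ ι (k + 1))
    (hι₂ : ∀ i : I, {k : ℕ | 1 ≤ k ∧ ι k = i}.Infinite)
    (lam : I → ℤ) (hlam : ∀ i, 0 ≤ lam i)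
    (hW : Finite ((coxOf A).Group))
    (w₀ : (coxOf A).Group)
    (hw₀ : ∀ w : (coxOf A).Group,
      (coxOf A).toCoxeterSystem.length w ≤ (coxOf A).toCoxeterSystem.length w₀)
    (l₀ : ℕ) (hl₀ : l₀ = (coxOf A).toCoxeterSystem.length w₀)
    (hword : (coxOf A).toCoxeterSystem.wordProd (demWord ι l₀) = w₀)
    (hred : (coxOf A).toCoxeterSystem.IsReduced (demWord ι l₀)) :
    (∀ x ∈ FSet A ι lam, ∀ k, l₀ < k → x k = 0) ∧
      Set.InjOn (fun x : ℕ →₀ ℤ => (fun n : Fin l₀ => x (n.val + 1)))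
        (FSet A ι lam) := by
  have key := fun x hx => FSet_induction (lam := lam) (x := x)
    (epsGE_lowerSeq_longest hAdiag hAoff hAzero hw₀ hred hword) hx
  refine ⟨fun x hx => (key x hx).2, fun x hx y hy hxy => ?_⟩
  ext k
  rcases Nat.eq_zero_or_pos k with rfl | hk
  · rw [(key x hx).1, (key y hy).1]
  rcases le_or_gt k l₀ with hkl | hkl
  · have h := congrFun hxy ⟨k - 1, by omega⟩
    simpa only [Nat.sub_add_cancel hk] using h
  · rw [(key x hx).2 k hkl, (key y hy).2 k hkl]

end PaperNakashima
end
end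

section
/- Let L ≥ 1 and let y ∈ ℤ^∞ satisfy y_k = 0 for all k ≥ L, β_j^{(−)}(y) = 0 for 1 ≤ j ≤ L−1, and β_L^{(−)}(y) < 0. Then σ^{(i_L)}(y) = 0, σ_0^{(i_L)}(y) = β_L^{(−)}(y), ε_{i_L}(y) = 0 and φ_{i_L}(y) = −β_L^{(−)}(y) > 0; moreover, for 0 ≤ m ≤ φ_{i_L}(y), f̃_{i_L}^m(y) equals y with L-th entry replaced by m. In particular f̃_{i_L}^{max}(y) := f̃_{i_L}^{φ_{i_L}(y)}(y) is y with L-th entry replaced by −β_L^{(−)}(y), and this element satisfies β_j^{(−)} = 0 for all 1 ≤ j ≤ L. -/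
noncomputable section

namespace PaperNakashima

variable {I : Type*} [DecidableEq I]

/-- `k^{(-)} = max { l : 1 ≤ l < k, i_l = i_k }` (`0` if there is no such `l`). -/
def kminus (ι : ℕ → I) (k : ℕ) : ℕ :=
  sSup {l | 1 ≤ l ∧ l < k ∧ ι l = ι k}

/-- The function `β_k^{(-)}`:
`β_k^{(-)}(x) = x_{k^{(-)}} + Σ_{k^{(-)}<j<k} a_{i_k i_j} x_j + x_k` if `k^{(-)} > 0`, and
`β_k^{(-)}(x) = -λ_{i_k} + Σ_{1≤j<k} a_{i_k i_j} x_j + x_k` if `k^{(-)} = 0`. -/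
def betaME (A : I → I → ℤ) (ι : ℕ → I) (lam : I → ℤ) (k : ℕ) (x : ℕ →₀ ℤ) : ℤ :=
  if kminus ι k = 0 then
    -lam (ι k) + (∑ j ∈ Finset.Ioo 0 k, A (ι k) (ι j) * x j) + x k
  else
    x (kminus ι k) + (∑ j ∈ Finset.Ioo (kminus ι k) k, A (ι k) (ι j) * x j) + x k

section Lemmas

variable {J : Type*} (A : J → J → ℤ) (ι : ℕ → J) (lam : J → ℤ)

lemma sum_support_filter_lt_eq_sum_Ioo (i : J) (k N : ℕ) (x : ℕ →₀ ℤ)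
    (hN : ∀ j, N ≤ j → x j = 0) :
    ∑ j ∈ x.support.filter (fun j => k < j), A i (ι j) * x j =
      ∑ j ∈ Finset.Ioo k N, A i (ι j) * x j := by
  refine Finset.sum_subset (fun j hj => ?_) (fun j hj hj' => ?_)
  · simp only [Finset.mem_filter, Finsupp.mem_support_iff] at hj
    exact Finset.mem_Ioo.2 ⟨hj.2, not_le.1 fun h => hj.1 (hN j h)⟩
  · have hk := (Finset.mem_Ioo.1 hj).1
    simp only [Finset.mem_filter, Finsupp.mem_support_iff, not_and] at hj'
    rw [not_not.1 fun h => hj' h hk, mul_zero]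

lemma sum_support_filter_lt_split (i : J) {k n : ℕ} (hkn : k < n) (x : ℕ →₀ ℤ) :
    ∑ j ∈ x.support.filter (fun j => k < j), A i (ι j) * x j =
      ∑ j ∈ Finset.Ioo k n, A i (ι j) * x j + A i (ι n) * x n +
        ∑ j ∈ x.support.filter (fun j => n < j), A i (ι j) * x j := by
  obtain ⟨N, hnN, hN⟩ : ∃ N, n < N ∧ ∀ j, N ≤ j → x j = 0 := by
    refine ⟨max (n + 1) (x.support.sup id + 1), by omega, fun j hj => ?_⟩
    by_contra h
    have := Finset.le_sup (f := id) (Finsupp.mem_support_iff.2 h)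
    simp only [id] at this
    omega
  rw [sum_support_filter_lt_eq_sum_Ioo A ι i k N x hN,
    sum_support_filter_lt_eq_sum_Ioo A ι i n N x hN]
  have hunion : Finset.Ioo k N = (insert n (Finset.Ioo k n)) ∪ Finset.Ioo n N := by
    ext j
    simp only [Finset.mem_union, Finset.mem_insert, Finset.mem_Ioo]
    omega
  rw [hunion, Finset.sum_union, Finset.sum_insert (by simp)]
  · ring
  · rw [Finset.disjoint_left]
    intro j
    simp only [Finset.mem_insert, Finset.mem_Ioo]
    omega

lemma kminus_bddAbove (k : ℕ) : BddAbove {l | 1 ≤ l ∧ l < k ∧ ι l = ι k} :=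
  ⟨k, fun _ h => h.2.1.le⟩

lemma le_kminus {k l : ℕ} (h₁ : 1 ≤ l) (h₂ : l < k) (h₃ : ι l = ι k) : l ≤ kminus ι k :=
  le_csSup (kminus_bddAbove ι k) ⟨h₁, h₂, h₃⟩

lemma kminus_mem {k : ℕ} (h : kminus ι k ≠ 0) :
    kminus ι k < k ∧ ι (kminus ι k) = ι k := by
  have hne : {l | 1 ≤ l ∧ l < k ∧ ι l = ι k}.Nonempty := by
    by_contra hempty
    rw [Set.not_nonempty_iff_eq_empty] at hempty
    exact h (by simp [kminus, hempty])
  exact (Nat.sSup_mem hne (kminus_bddAbove ι k)).2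

lemma sig_kminus (hAdiag : ∀ i, A i i = 2) {k : ℕ} (h : kminus ι k ≠ 0) (x : ℕ →₀ ℤ) :
    sig A ι (kminus ι k) x = betaME A ι lam k x + sig A ι k x := by
  obtain ⟨hlt, heq⟩ := kminus_mem ι h
  rw [betaME, if_neg h, sig, sig, sum_support_filter_lt_split A ι _ hlt, heq, hAdiag]
  ring

lemma sig0_eq_of_kminus_eq_zero (hAdiag : ∀ i, A i i = 2) {k : ℕ} (hk : 1 ≤ k)
    (h : kminus ι k = 0) (x : ℕ →₀ ℤ) :
    sig0 A ι lam (ι k) x = betaME A ι lam k x + sig A ι k x := by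
  have hsplit := sum_support_filter_lt_split A ι (ι k) (show 0 < k from hk) x
  rw [betaME, if_pos h, sig, sig0]
  simp only [Nat.succ_le_iff, hsplit, hAdiag]
  ring

/-- If `β_j^{(-)}(x) = 0` for `1 ≤ j < n`, then `σ_0^{(i_n)}(x)` and all `σ_k(x)` with `k < n`,
`i_k = i_n` take the common value `β_n^{(-)}(x) + σ_n(x)`. -/
lemma sig_eq_of_betaME_eq_zero (hAdiag : ∀ i, A i i = 2) (x : ℕ →₀ ℤ) (n : ℕ) (hn : 1 ≤ n)
    (hbeta : ∀ j, 1 ≤ j → j < n → betaME A ι lam j x = 0) :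
    sig0 A ι lam (ι n) x = betaME A ι lam n x + sig A ι n x ∧
      ∀ k, 1 ≤ k → k < n → ι k = ι n → sig A ι k x = betaME A ι lam n x + sig A ι n x := by
  induction n using Nat.strong_induction_on with
  | _ n ih =>
    by_cases h : kminus ι n = 0
    · refine ⟨sig0_eq_of_kminus_eq_zero A ι lam hAdiag hn h x, fun k hk hkn hkι => ?_⟩
      have := le_kminus ι hk hkn hkι
      omega
    · obtain ⟨hlt, heq⟩ := kminus_mem ι h
      have hpos : 1 ≤ kminus ι n := Nat.one_le_iff_ne_zero.2 h
      have hstep := sig_kminus A ι lam hAdiag h x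
      obtain ⟨ih₀, ih₁⟩ := ih _ hlt hpos fun j hj hjl => hbeta j hj (hjl.trans hlt)
      rw [hbeta _ hpos hlt, zero_add, hstep] at ih₀ ih₁
      refine ⟨heq ▸ ih₀, fun k hk hkn hkι => ?_⟩
      rcases (le_kminus ι hk hkn hkι).eq_or_lt with rfl | hkl
      · exact hstep
      · exact ih₁ k hk hkl (hkι.trans heq.symm)

lemma sig_eq_apply {k : ℕ} {x : ℕ →₀ ℤ} (h : ∀ j, k < j → x j = 0) : sig A ι k x = x k := by
  rw [sig, sum_support_filter_lt_eq_sum_Ioo A ι _ k (k + 1) x h,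
    Finset.sum_eq_zero fun j hj => by rw [h j (Finset.mem_Ioo.1 hj).1, mul_zero], add_zero]

/-- `β_k^{(-)}(x)` depends on the entries `x_j` with `j < k` and is linear in `x_k`. -/
lemma betaME_eq_add_of_forall_lt {k : ℕ} {x z : ℕ →₀ ℤ}
    (h : ∀ j, j < k → z j = x j) :
    betaME A ι lam k z = betaME A ι lam k x + (z k - x k) := by
  have hsum : ∀ l, ∑ j ∈ Finset.Ioo l k, A (ι k) (ι j) * z j =
      ∑ j ∈ Finset.Ioo l k, A (ι k) (ι j) * x j := fun l =>
    Finset.sum_congr rfl fun j hj => by rw [h j (Finset.mem_Ioo.1 hj).2]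
  unfold betaME
  split_ifs with h0
  · rw [hsum]
    ring
  · rw [hsum, h _ (kminus_mem ι h0).1]
    ring

/-- If `σ_L` is maximal among the `σ_k`, `i_k = i_L`, and strictly larger than those with `k < L`, then
`σ^{(i_L)}` is attained first at `L`. -/
lemma sigMax_eq_and_sInf_Mset_eq {L : ℕ} (hL : 1 ≤ L) (x : ℕ →₀ ℤ)
    (hle : ∀ k, L ≤ k → ι k = ι L → sig A ι k x ≤ sig A ι L x)
    (hlt : ∀ k, 1 ≤ k → k < L → ι k = ι L → sig A ι k x < sig A ι L x) :
    sigMax A ι (ι L) x = sig A ι L x ∧ sInf (Mset A ι (ι L) x) = L := by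
  have hmax : sigMax A ι (ι L) x = sig A ι L x := by
    refine IsGreatest.csSup_eq ⟨⟨L, ⟨hL, rfl⟩, rfl⟩, ?_⟩
    rintro _ ⟨k, ⟨hk, hkι⟩, rfl⟩
    rcases lt_or_ge k L with hkL | hkL
    · exact (hlt k hk hkL hkι).le
    · exact hle k hkL hkι
  refine ⟨hmax, IsLeast.csInf_eq ⟨⟨hL, rfl, hmax.symm⟩, ?_⟩⟩
  rintro k ⟨hk, hkι, hkmax⟩
  by_contra! hkL
  exact (hlt k hk hkL hkι).ne (hkmax.trans hmax)

/-- The values of `σ_0^{(i_L)}`, `σ^{(i_L)}` and `min M^{(i_L)}` along the `f̃_{i_L}`-string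
through `y`. -/
lemma sig0_sigMax_sInf_Mset_add_single (hAdiag : ∀ i, A i i = 2) {L : ℕ} (hL : 1 ≤ L)
    {y : ℕ →₀ ℤ} (hyL : ∀ k, L ≤ k → y k = 0)
    (hbeta : ∀ j, 1 ≤ j → j < L → betaME A ι lam j y = 0) {m : ℕ}
    (hm : (m : ℤ) < -betaME A ι lam L y) :
    sig0 A ι lam (ι L) (y + Finsupp.single L (m : ℤ)) = betaME A ι lam L y + 2 * m ∧
      sigMax A ι (ι L) (y + Finsupp.single L (m : ℤ)) = m ∧
      sInf (Mset A ι (ι L) (y + Finsupp.single L (m : ℤ))) = L := by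
  set z := y + Finsupp.single L (m : ℤ) with hz
  have hz_ne : ∀ j, j ≠ L → z j = y j := fun j hj => by
    simp [hz, Finsupp.single_eq_of_ne hj]
  have hzL : z L = m := by simp [hz, hyL L le_rfl]
  have hz_gt : ∀ j, L < j → z j = 0 := fun j hj => by rw [hz_ne j hj.ne', hyL j hj.le]
  have hβL : betaME A ι lam L z = betaME A ι lam L y + m := by
    rw [betaME_eq_add_of_forall_lt A ι lam fun j hj => hz_ne j hj.ne, hzL, hyL L le_rfl, sub_zero]
  have hβ : ∀ j, 1 ≤ j → j < L → betaME A ι lam j z = 0 := fun j hj hjL => by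
    rw [betaME_eq_add_of_forall_lt A ι lam fun i hi => hz_ne i (hi.trans hjL).ne,
      hz_ne j hjL.ne, hbeta j hj hjL, sub_self, add_zero]
  have hσL : sig A ι L z = m := by rw [sig_eq_apply A ι hz_gt, hzL]
  obtain ⟨h₀, h₁⟩ := sig_eq_of_betaME_eq_zero A ι lam hAdiag z L hL hβ
  rw [hβL, hσL] at h₀ h₁
  refine ⟨by rw [h₀]; ring, hσL ▸ sigMax_eq_and_sInf_Mset_eq A ι hL z (fun k hk _ => ?_)
    fun k hk hkL hkι => ?_⟩
  · rcases hk.eq_or_lt with rfl | hk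
    · exact le_rfl
    · rw [hσL, sig_eq_apply A ι fun j hj => hz_gt j (hk.trans hj), hz_gt k hk]
      positivity
  · rw [h₁ k hk hkL hkι, hσL]
    linarith

end Lemmas

/-- Suppose `y ∈ ℤ^∞` satisfies `y_k = 0` for `k ≥ L`, `β_j^{(-)}(y) = 0` for
`1 ≤ j ≤ L−1`, and `β_L^{(-)}(y) < 0`. Then `σ^{(i_L)}(y) = 0`,
`σ_0^{(i_L)}(y) = β_L^{(-)}(y)`, `ε_{i_L}(y) = 0`, `φ_{i_L}(y) = −β_L^{(-)}(y) > 0`; for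
`0 ≤ m ≤ φ_{i_L}(y)` the element `f̃_{i_L}^m(y)` is `y` with its `L`-th entry replaced by `m`;
in particular `f̃_{i_L}^{max}(y) = f̃_{i_L}^{φ_{i_L}(y)}(y)` is `y` with `L`-th entry
`−β_L^{(-)}(y)`, and it satisfies `β_j^{(-)} = 0` for all `1 ≤ j ≤ L`. -/
theorem ftil_max_of_beta_neg {I : Type*} [Fintype I] [DecidableEq I]
    (A : I → I → ℤ)
    (hAdiag : ∀ i, A i i = 2)
    (hAoff : ∀ i j, i ≠ j → A i j ≤ 0)
    (hAzero : ∀ i j, A i j = 0 ↔ A j i = 0)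
    (hAsym : ∃ d : I → ℤ, (∀ i, 0 < d i) ∧ ∀ i j, d i * A i j = d j * A j i)
    (ι : ℕ → I)
    (hι₁ : ∀ k, 1 ≤ k → ι k ≠ ι (k + 1))
    (hι₂ : ∀ i : I, {k : ℕ | 1 ≤ k ∧ ι k = i}.Infinite)
    (lam : I → ℤ) (hlam : ∀ i, 0 ≤ lam i)
    (L : ℕ) (hL : 1 ≤ L)
    (y : ℕ →₀ ℤ) (hy0 : y 0 = 0) (hyL : ∀ k, L ≤ k → y k = 0)
    (hbeta : ∀ j, 1 ≤ j → j ≤ L - 1 → betaME A ι lam j y = 0)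
    (hneg : betaME A ι lam L y < 0) :
    sigMax A ι (ι L) y = 0 ∧
    sig0 A ι lam (ι L) y = betaME A ι lam L y ∧
    eps A ι lam (ι L) y = 0 ∧
    phi A ι lam (ι L) y = -betaME A ι lam L y ∧
    0 < phi A ι lam (ι L) y ∧
    (∀ m : ℕ, (m : ℤ) ≤ phi A ι lam (ι L) y →
      (ftil A ι lam (ι L))^[m] (some y) = some (y + Finsupp.single L (m : ℤ))) ∧
    (ftil A ι lam (ι L))^[(phi A ι lam (ι L) y).toNat] (some y) =
      some (y + Finsupp.single L (-betaME A ι lam L y)) ∧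
    (∀ j, 1 ≤ j → j ≤ L →
      betaME A ι lam j (y + Finsupp.single L (-betaME A ι lam L y)) = 0) := by
  have hbeta' : ∀ j, 1 ≤ j → j < L → betaME A ι lam j y = 0 := fun j hj hjL =>
    hbeta j hj (by omega)
  have string := fun m : ℕ =>
    sig0_sigMax_sInf_Mset_add_single A ι lam hAdiag hL hyL hbeta' (m := m)
  obtain ⟨hσ0, hσ, -⟩ := string 0 (by simpa using hneg)
  simp only [Nat.cast_zero, Finsupp.single_zero, add_zero, mul_zero] at hσ0 hσ
  have heps : eps A ι lam (ι L) y = 0 := by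
    rw [eps, hσ, hσ0, max_eq_left hneg.le]
  have hphi : phi A ι lam (ι L) y = -betaME A ι lam L y := by
    rw [phi, heps, hσ0, zero_sub]
  have hiter : ∀ m : ℕ, (m : ℤ) ≤ phi A ι lam (ι L) y →
      (ftil A ι lam (ι L))^[m] (some y) = some (y + Finsupp.single L (m : ℤ)) := by
    intro m
    induction m with
    | zero => simp
    | succ m ih =>
      intro hm
      rw [hphi] at hm ih
      push_cast at hm
      obtain ⟨h0, hmax, hinf⟩ := string m (by linarith)
      rw [Function.iterate_succ_apply', ih (by linarith), ftil, h0, hmax, hinf,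
        if_pos (by linarith), add_assoc, ← Finsupp.single_add]
      push_cast
      rfl
  have hpos : 0 < phi A ι lam (ι L) y := by rw [hphi]; linarith
  refine ⟨hσ, hσ0, heps, hphi, hpos, hiter, ?_, fun j hj hjL => ?_⟩
  · have hcast := Int.toNat_of_nonneg hpos.le
    rw [hiter _ hcast.le, hcast, hphi]
  · rw [betaME_eq_add_of_forall_lt A ι lam (x := y) fun i hi => by
      simp [Finsupp.single_eq_of_ne (hi.trans_le hjL).ne]]
    rcases hjL.eq_or_lt with rfl | hjL
    · simp
    · simp [hbeta' j hj hjL, Finsupp.single_eq_of_ne hjL.ne]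

end PaperNakashima
end
end

section
/- Let L ≥ 1 and let y ∈ ℤ^∞ satisfy y_k = 0 for all k ≥ L, β_j^{(−)}(y) = 0 for 1 ≤ j ≤ L−1, and β_L^{(−)}(y) ≥ 0. Then σ^{(i_L)}(y) = σ_0^{(i_L)}(y) = β_L^{(−)}(y), hence f̃_{i_L}(y) = 0 and φ_{i_L}(y) = 0, so that f̃_{i_L}^{max}(y) := f̃_{i_L}^{φ_{i_L}(y)}(y) = y. -/
noncomputable section

namespace PaperNakashima

variable {I : Type*} [DecidableEq I]

/-- `⟨h_i, λ - Σ_j c_j α_j⟩`. -/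
def pairing [Fintype I] (A : I → I → ℤ) (lam : I → ℤ) (c : I → ℤ) (i : I) : ℤ :=
  lam i - ∑ j, A i j * c j

/-- The simple reflection `s_i` acting on the weight `λ - Σ_j c_j α_j`, in terms of the
coefficients `c`. -/
def fire [Fintype I] (A : I → I → ℤ) (lam : I → ℤ) (c : I → ℤ) (i : I) : I → ℤ :=
  c + pairing A lam c i • Pi.single i 1

/-- The weights reachable from `λ` by `n` simple reflections, each of which strictly lowers the
weight (a legal play of length `n` in the numbers game of Mozes). -/
inductive LegalPlay [Fintype I] (A : I → I → ℤ) (lam : I → ℤ) : ℕ → (I → ℤ) → Prop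
  | zero : LegalPlay A lam 0 0
  | step {n : ℕ} {c : I → ℤ} (i : I) : LegalPlay A lam n c → 0 < pairing A lam c i →
      LegalPlay A lam (n + 1) (fire A lam c i)

section NumbersGame

variable [Fintype I] {A : I → I → ℤ} {lam : I → ℤ}

lemma pairing_fire (c : I → ℤ) (i k : I) :
    pairing A lam (fire A lam c i) k = pairing A lam c k - A k i * pairing A lam c i := by
  have h : ∑ j, A k j * fire A lam c i j =
      ∑ j, A k j * c j + A k i * pairing A lam c i := by
    simp [fire, mul_add, Finset.sum_add_distrib, Pi.single_apply]
  rw [pairing, h, ← sub_sub, ← pairing]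

lemma fire_apply (c : I → ℤ) (i k : I) :
    fire A lam c i k = c k + pairing A lam c i * (Pi.single i 1 : I → ℤ) k := by
  simp [fire]

lemma fire_fire_self (hA : ∀ i, A i i = 2) (c : I → ℤ) (i : I) :
    fire A lam (fire A lam c i) i = c := by
  rw [fire, pairing_fire, hA, fire]
  module

lemma LegalPlay.nonneg {n : ℕ} {c : I → ℤ} (h : LegalPlay A lam n c) (i : I) : 0 ≤ c i := by
  induction h with
  | zero => exact le_rfl
  | step j _ hpos ih =>
    by_cases hij : i = j
    · subst hij
      simp [fire]
      omega
    · simpa [fire, hij] using ih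

/-- Every weight that is reached by a legal play of length `m` and pairs negatively with `h_i` is
obtained from a legal play of length `m - 1` by reflecting in `i`. -/
def Descends (A : I → I → ℤ) (lam : I → ℤ) (m : ℕ) : Prop :=
  ∀ c i, LegalPlay A lam m c → pairing A lam c i < 0 →
    ∃ k, m = k + 1 ∧ LegalPlay A lam k (fire A lam c i)

lemma Descends.fire_of_le {n m : ℕ} (H : ∀ m ≤ n, Descends A lam m) (hm : m ≤ n) {c : I → ℤ}
    {i : I} (hc : LegalPlay A lam m c) (hi : pairing A lam c i < 0) :
    ∃ k, m = k + 1 ∧ k ≤ n ∧ LegalPlay A lam k (fire A lam c i) := by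
  obtain ⟨k, hk, hl⟩ := H m hm c i hc hi
  exact ⟨k, hk, by omega, hl⟩

/-- In an infinite rank two parabolic one can never be strictly below both walls: one would
descend forever. -/
lemma not_legalPlay_of_four_le (hA : ∀ i, A i i = 2) (n : ℕ) (H : ∀ m ≤ n, Descends A lam m) :
    ∀ m ≤ n, ∀ (c : I → ℤ) (i j : I), A i j ≤ 0 → A j i ≤ 0 → 4 ≤ A i j * A j i →
      LegalPlay A lam m c → pairing A lam c i < 0 → 0 < pairing A lam c j →
      2 * pairing A lam c j ≤ A j i * pairing A lam c i → False := by
  intro m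
  induction m with
  | zero =>
    intro hm c i j _ _ _ hc hi
    obtain ⟨k, hk, -⟩ := H 0 hm c i hc hi
    omega
  | succ m ih =>
    intro hm c i j hij hji h4 hc hi hj h2
    obtain ⟨k, hk, hl⟩ := H _ hm c i hc hi
    obtain rfl : m = k := by omega
    refine ih (by omega) _ j i hji hij (by linarith) hl ?_ ?_ ?_ <;>
      simp only [pairing_fire, hA]
    · linarith
    · linarith
    · nlinarith [mul_nonneg (neg_nonneg.2 hij) (sub_nonneg.2 h2),
        mul_nonneg (sub_nonneg.2 h4) (neg_nonneg.2 hi.le)]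

lemma rank_two_cases {u v : ℤ} (hu : u ≤ 0) (hv : v ≤ 0) (h0 : u = 0 ↔ v = 0) :
    (u = 0 ∧ v = 0) ∨ (u = -1 ∧ v = -1) ∨ (u = -1 ∧ v = -2 ∨ u = -2 ∧ v = -1) ∨
      (u = -1 ∧ v = -3 ∨ u = -3 ∧ v = -1) ∨ 4 ≤ u * v := by
  by_cases h4 : 4 ≤ u * v
  · tauto
  by_cases hu0 : u = 0
  · exact Or.inl ⟨hu0, h0.1 hu0⟩
  have hv0 : v ≠ 0 := fun h => hu0 (h0.2 h)
  have hu1 : u ≤ -1 := by omega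
  have hv1 : v ≤ -1 := by omega
  have hu3 : -3 ≤ u := by nlinarith
  have hv3 : -3 ≤ v := by nlinarith
  interval_cases u <;> interval_cases v <;> omega

lemma descends_succ (hA : ∀ i, A i i = 2) (hoff : ∀ i j, i ≠ j → A i j ≤ 0)
    (hzero : ∀ i j, A i j = 0 ↔ A j i = 0) {n : ℕ} (H : ∀ m ≤ n, Descends A lam m) :
    Descends A lam (n + 1) := by
  intro c i hc hi
  refine ⟨n, rfl, ?_⟩
  cases hc with
  | @step _ c j hc hpos =>
  by_cases hij : i = j
  · subst hij
    rwa [fire_fire_self hA]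
  have hu := hoff i j hij
  have hv := hoff j i (Ne.symm hij)
  rw [pairing_fire] at hi
  have hi' : pairing A lam c i < 0 := by nlinarith
  rcases rank_two_cases hu hv (hzero i j) with ⟨h1, h2⟩ | ⟨h1, h2⟩ | h | h | h4
  · rw [h1] at hi
    obtain ⟨k, rfl, hk1, l1⟩ := Descends.fire_of_le H le_rfl hc hi'
    have r1 := l1.step j (by simp only [pairing_fire, h2]; linarith)
    convert r1 using 1
    funext t
    simp only [fire_apply, pairing_fire, h1, h2]
    ring
  · rw [h1] at hi
    obtain ⟨k, rfl, hk1, l1⟩ := Descends.fire_of_le H le_rfl hc hi'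
    obtain ⟨k, rfl, hk2, l2⟩ := Descends.fire_of_le H hk1 l1 (i := j)
        (by simp only [pairing_fire, h2]; linarith)
    have r1 := l2.step i (by simp only [pairing_fire, hA, h1, h2]; linarith)
    have r2 := r1.step j (by simp only [pairing_fire, hA, h1, h2]; linarith)
    convert r2 using 1
    funext t
    simp only [fire_apply, pairing_fire, hA, h1, h2]
    ring
  · obtain ⟨h1, h2⟩ | ⟨h1, h2⟩ := h
    all_goals
      rw [h1] at hi
      obtain ⟨k, rfl, hk1, l1⟩ := Descends.fire_of_le H le_rfl hc hi'
      obtain ⟨k, rfl, hk2, l2⟩ := Descends.fire_of_le H hk1 l1 (i := j)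
          (by simp only [pairing_fire, h2]; linarith)
      obtain ⟨k, rfl, hk3, l3⟩ := Descends.fire_of_le H hk2 l2 (i := i)
          (by simp only [pairing_fire, hA, h1, h2]; linarith)
      have r1 := l3.step j (by simp only [pairing_fire, hA, h1, h2]; linarith)
      have r2 := r1.step i (by simp only [pairing_fire, hA, h1, h2]; linarith)
      have r3 := r2.step j (by simp only [pairing_fire, hA, h1, h2]; linarith)
      convert r3 using 1
      funext t
      simp only [fire_apply, pairing_fire, hA, h1, h2]
      ring
  · obtain ⟨h1, h2⟩ | ⟨h1, h2⟩ := h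
    all_goals
      rw [h1] at hi
      obtain ⟨k, rfl, hk1, l1⟩ := Descends.fire_of_le H le_rfl hc hi'
      obtain ⟨k, rfl, hk2, l2⟩ := Descends.fire_of_le H hk1 l1 (i := j)
          (by simp only [pairing_fire, h2]; linarith)
      obtain ⟨k, rfl, hk3, l3⟩ := Descends.fire_of_le H hk2 l2 (i := i)
          (by simp only [pairing_fire, hA, h1, h2]; linarith)
      obtain ⟨k, rfl, hk4, l4⟩ := Descends.fire_of_le H hk3 l3 (i := j)
          (by simp only [pairing_fire, hA, h1, h2]; linarith)
      obtain ⟨k, rfl, hk5, l5⟩ := Descends.fire_of_le H hk4 l4 (i := i)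
          (by simp only [pairing_fire, hA, h1, h2]; linarith)
      have r1 := l5.step j (by simp only [pairing_fire, hA, h1, h2]; linarith)
      have r2 := r1.step i (by simp only [pairing_fire, hA, h1, h2]; linarith)
      have r3 := r2.step j (by simp only [pairing_fire, hA, h1, h2]; linarith)
      have r4 := r3.step i (by simp only [pairing_fire, hA, h1, h2]; linarith)
      have r5 := r4.step j (by simp only [pairing_fire, hA, h1, h2]; linarith)
      convert r5 using 1
      funext t
      simp only [fire_apply, pairing_fire, hA, h1, h2]
      ring
  · exact (not_legalPlay_of_four_le hA n H n le_rfl c i j hu hv h4 hc hi' hpos (by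
      nlinarith [mul_nonneg_of_nonpos_of_nonpos hv (sub_neg.2 hi).le])).elim

lemma descends (hA : ∀ i, A i i = 2) (hoff : ∀ i j, i ≠ j → A i j ≤ 0)
    (hzero : ∀ i j, A i j = 0 ↔ A j i = 0) (hlam : ∀ i, 0 ≤ lam i) (n : ℕ) :
    Descends A lam n := by
  induction n using Nat.strong_induction_on with
  | _ n ih =>
    cases n with
    | zero =>
      intro c i hc hi
      cases hc
      simp only [pairing, Pi.zero_apply, mul_zero, Finset.sum_const_zero, sub_zero] at hi
      exact absurd (hlam i) hi.not_ge
    | succ n => exact descends_succ hA hoff hzero fun m hm => ih m (Nat.lt_succ_of_le hm)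

/-- The legally reachable weights are stable under all simple reflections, so they make up the
whole Weyl group orbit of `λ`. -/
lemma LegalPlay.exists_fire (hA : ∀ i, A i i = 2) (hoff : ∀ i j, i ≠ j → A i j ≤ 0)
    (hzero : ∀ i j, A i j = 0 ↔ A j i = 0) (hlam : ∀ i, 0 ≤ lam i) {n : ℕ} {c : I → ℤ}
    (hc : LegalPlay A lam n c) (i : I) : ∃ m, LegalPlay A lam m (fire A lam c i) := by
  rcases lt_trichotomy (pairing A lam c i) 0 with h | h | h
  · obtain ⟨k, -, hk⟩ := descends hA hoff hzero hlam n c i hc h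
    exact ⟨k, hk⟩
  · exact ⟨n, by simpa [fire, h] using hc⟩
  · exact ⟨n + 1, hc.step i h⟩

end NumbersGame

lemma sum_Ioo_split (f : ℕ → ℤ) {a b c : ℕ} (hab : a < b) (hbc : b < c) :
    ∑ j ∈ Finset.Ioo a c, f j =
      ∑ j ∈ Finset.Ioo a b, f j + f b + ∑ j ∈ Finset.Ioo b c, f j := by
  have h : Finset.Ioo a c = insert b (Finset.Ioo a b ∪ Finset.Ioo b c) := by
    ext x
    simp only [Finset.mem_Ioo, Finset.mem_insert, Finset.mem_union]
    omega
  have hd : Disjoint (Finset.Ioo a b) (Finset.Ioo b c) := by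
    rw [Finset.disjoint_left]
    simp only [Finset.mem_Ioo]
    omega
  rw [h, Finset.sum_insert (by simp), Finset.sum_union hd]
  ring

/-- The defect of `y` from satisfying `y_k = ⟨h_{i_k}, λ - Σ_{j<k} y_j α_{i_j}⟩`. -/
def defect (A : I → I → ℤ) (ι : ℕ → I) (lam : I → ℤ) (k : ℕ) (y : ℕ →₀ ℤ) : ℤ :=
  y k - lam (ι k) + ∑ j ∈ Finset.Ioo 0 k, A (ι k) (ι j) * y j

lemma kminus_spec (ι : ℕ → I) {k : ℕ} (h : kminus ι k ≠ 0) :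
    1 ≤ kminus ι k ∧ kminus ι k < k ∧ ι (kminus ι k) = ι k := by
  refine Nat.sSup_mem (s := {l | 1 ≤ l ∧ l < k ∧ ι l = ι k}) ?_ ⟨k, fun l hl => hl.2.1.le⟩
  by_contra hne
  rw [Set.not_nonempty_iff_eq_empty] at hne
  exact h (by rw [kminus, hne, csSup_empty]; rfl)

lemma betaME_of_kminus_eq_zero {A : I → I → ℤ} {ι : ℕ → I} {lam : I → ℤ} {k : ℕ}
    (h : kminus ι k = 0) (y : ℕ →₀ ℤ) :
    betaME A ι lam k y = defect A ι lam k y := by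
  rw [betaME, if_pos h, defect]
  ring

lemma betaME_of_kminus_ne_zero {A : I → I → ℤ} (hA : ∀ i, A i i = 2) {ι : ℕ → I} {lam : I → ℤ}
    {k : ℕ} (h : kminus ι k ≠ 0) (y : ℕ →₀ ℤ) :
    betaME A ι lam k y = defect A ι lam k y - defect A ι lam (kminus ι k) y := by
  obtain ⟨h1, h2, h3⟩ := kminus_spec ι h
  rw [betaME, if_neg h, defect, defect, sum_Ioo_split _ h1 h2, h3, hA]
  ring

section Vanishing

variable {A : I → I → ℤ} {ι : ℕ → I} {lam : I → ℤ} {L : ℕ} {y : ℕ →₀ ℤ}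

lemma defect_eq_zero (hA : ∀ i, A i i = 2)
    (hbeta : ∀ j, 1 ≤ j → j ≤ L - 1 → betaME A ι lam j y = 0) {k : ℕ} (hk : 1 ≤ k)
    (hkL : k < L) : defect A ι lam k y = 0 := by
  induction k using Nat.strong_induction_on with
  | _ k ih =>
    have hb := hbeta k hk (by omega)
    by_cases h : kminus ι k = 0
    · rwa [betaME_of_kminus_eq_zero h] at hb
    · obtain ⟨h1, h2, -⟩ := kminus_spec ι h
      rwa [betaME_of_kminus_ne_zero hA h, ih _ h2 h1 (by omega), sub_zero] at hb

lemma betaME_eq_defect (hA : ∀ i, A i i = 2)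
    (hbeta : ∀ j, 1 ≤ j → j ≤ L - 1 → betaME A ι lam j y = 0) :
    betaME A ι lam L y = defect A ι lam L y := by
  by_cases h : kminus ι L = 0
  · exact betaME_of_kminus_eq_zero h y
  · obtain ⟨h1, h2, -⟩ := kminus_spec ι h
    rw [betaME_of_kminus_ne_zero hA h, defect_eq_zero hA hbeta h1 h2, sub_zero]

lemma sum_support_filter_eq (hyL : ∀ k, L ≤ k → y k = 0) (k : ℕ) (f : ℕ → ℤ) :
    ∑ j ∈ y.support.filter (fun j => k < j), f j * y j = ∑ j ∈ Finset.Ioo k L, f j * y j := by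
  refine Finset.sum_subset (fun j hj => ?_) (fun j hj hj' => ?_)
  · simp only [Finset.mem_filter, Finsupp.mem_support_iff] at hj
    exact Finset.mem_Ioo.2 ⟨hj.2, not_le.1 fun h => hj.1 (hyL j h)⟩
  · simp only [Finset.mem_filter, Finsupp.mem_support_iff, not_and'] at hj'
    rw [not_not.1 (hj' (Finset.mem_Ioo.1 hj).1), mul_zero]

lemma sig0_eq_defect (hyL : ∀ k, L ≤ k → y k = 0) :
    sig0 A ι lam (ι L) y = defect A ι lam L y := by
  rw [sig0, defect, hyL L le_rfl, zero_sub]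
  exact congrArg _ (sum_support_filter_eq hyL 0 _)

lemma sig_of_le (hyL : ∀ k, L ≤ k → y k = 0) {k : ℕ} (hk : L ≤ k) : sig A ι k y = 0 := by
  rw [sig, sum_support_filter_eq hyL, Finset.Ioo_eq_empty (by omega), hyL k hk]
  simp

lemma sig_of_lt (hA : ∀ i, A i i = 2) (hyL : ∀ k, L ≤ k → y k = 0) {k : ℕ} (hk : 1 ≤ k)
    (hkL : k < L) (hι : ι k = ι L) :
    sig A ι k y = defect A ι lam L y - defect A ι lam k y := by
  rw [sig, sum_support_filter_eq hyL, defect, defect, sum_Ioo_split _ hk hkL, hyL L le_rfl, hι, hA]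
  ring

lemma pairing_sum_single [Fintype I] (k : ℕ) (i : I) :
    pairing A lam (∑ j ∈ Finset.Ioo 0 k, y j • Pi.single (ι j) 1) i =
      lam i - ∑ j ∈ Finset.Ioo 0 k, A i (ι j) * y j := by
  simp only [pairing, Finset.sum_apply, Pi.smul_apply, smul_eq_mul, Finset.mul_sum]
  rw [Finset.sum_comm]
  simp [Pi.single_apply]

/-- The weights `λ - Σ_{0<j<k} y_j α_{i_j}` lie in the Weyl group orbit of `λ`. -/
lemma exists_legalPlay [Fintype I] (hA : ∀ i, A i i = 2) (hoff : ∀ i j, i ≠ j → A i j ≤ 0)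
    (hzero : ∀ i j, A i j = 0 ↔ A j i = 0) (hlam : ∀ i, 0 ≤ lam i) {k : ℕ}
    (hdef : ∀ j, 1 ≤ j → j < k → defect A ι lam j y = 0) :
    ∃ n, LegalPlay A lam n (∑ j ∈ Finset.Ioo 0 k, y j • Pi.single (ι j) 1) := by
  induction k with
  | zero => exact ⟨0, LegalPlay.zero⟩
  | succ k ih =>
    rcases Nat.eq_zero_or_pos k with rfl | hk
    · exact ⟨0, LegalPlay.zero⟩
    obtain ⟨n, hn⟩ := ih fun j h1 h2 => hdef j h1 (by omega)
    obtain ⟨m, hm⟩ := hn.exists_fire hA hoff hzero hlam (ι k)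
    refine ⟨m, ?_⟩
    have hy : y k = pairing A lam (∑ j ∈ Finset.Ioo 0 k, y j • Pi.single (ι j) 1) (ι k) := by
      have := hdef k hk k.lt_succ_self
      rw [pairing_sum_single]
      rw [defect] at this
      linarith
    have hI : Finset.Ioo 0 (k + 1) = insert k (Finset.Ioo 0 k) := by
      ext x
      simp only [Finset.mem_Ioo, Finset.mem_insert]
      omega
    rw [fire, ← hy] at hm
    rwa [hI, Finset.sum_insert (by simp), add_comm]

/-- If `i_L` does not occur among `i_1, …, i_{L-1}`, then `λ - Σ_j y_j α_{i_j}` pairs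
nonnegatively with `h_{i_L}`. -/
lemma defect_nonpos [Fintype I] (hA : ∀ i, A i i = 2) (hoff : ∀ i j, i ≠ j → A i j ≤ 0)
    (hzero : ∀ i j, A i j = 0 ↔ A j i = 0) (hlam : ∀ i, 0 ≤ lam i)
    (hyL : ∀ k, L ≤ k → y k = 0) (hdef : ∀ j, 1 ≤ j → j < L → defect A ι lam j y = 0)
    (hne : ∀ j, 1 ≤ j → j < L → ι j ≠ ι L) : defect A ι lam L y ≤ 0 := by
  obtain ⟨n, hn⟩ := exists_legalPlay hA hoff hzero hlam hdef
  have hp := pairing_sum_single (A := A) (lam := lam) (ι := ι) (y := y) L (ι L)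
  set c : I → ℤ := ∑ j ∈ Finset.Ioo 0 L, y j • Pi.single (ι j) 1 with hc
  have hcL : c (ι L) = 0 := by
    rw [hc, Finset.sum_apply]
    refine Finset.sum_eq_zero fun j hj => ?_
    have hj := Finset.mem_Ioo.1 hj
    simp [(hne j hj.1 hj.2).symm]
  have hle : ∑ j, A (ι L) j * c j ≤ 0 := by
    refine Finset.sum_nonpos fun j _ => ?_
    by_cases hj : ι L = j
    · rw [← hj, hcL, mul_zero]
    · exact mul_nonpos_of_nonpos_of_nonneg (hoff _ _ hj) (hn.nonneg j)
  rw [pairing] at hp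
  rw [defect, hyL L le_rfl]
  linarith [hlam (ι L)]

lemma sigMax_eq_defect [Fintype I] (hA : ∀ i, A i i = 2) (hoff : ∀ i j, i ≠ j → A i j ≤ 0)
    (hzero : ∀ i j, A i j = 0 ↔ A j i = 0) (hlam : ∀ i, 0 ≤ lam i) (hL : 1 ≤ L)
    (hyL : ∀ k, L ≤ k → y k = 0) (hdef : ∀ j, 1 ≤ j → j < L → defect A ι lam j y = 0)
    (hnonneg : 0 ≤ defect A ι lam L y) :
    sigMax A ι (ι L) y = defect A ι lam L y := by
  refine IsGreatest.csSup_eq ⟨?_, ?_⟩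
  · by_cases h : ∃ j, 1 ≤ j ∧ j < L ∧ ι j = ι L
    · obtain ⟨j, h1, h2, h3⟩ := h
      exact ⟨j, ⟨h1, h3⟩, by
        simp only [sig_of_lt hA hyL h1 h2 h3 (lam := lam), hdef j h1 h2, sub_zero]⟩
    · push Not at h
      refine ⟨L, ⟨hL, rfl⟩, ?_⟩
      exact (sig_of_le hyL le_rfl).trans
        (hnonneg.antisymm (defect_nonpos hA hoff hzero hlam hyL hdef h))
  · rintro _ ⟨k, ⟨h1, h2⟩, rfl⟩
    rcases lt_or_ge k L with h | h
    · simp only [sig_of_lt hA hyL h1 h h2 (lam := lam), hdef k h1 h, sub_zero, le_refl]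
    · simpa only [sig_of_le hyL h] using hnonneg

end Vanishing

/-- Suppose `y ∈ ℤ^∞` satisfies `y_k = 0` for `k ≥ L`, `β_j^{(-)}(y) = 0`
for `1 ≤ j ≤ L−1`, and `β_L^{(-)}(y) ≥ 0`. Then
`σ^{(i_L)}(y) = σ_0^{(i_L)}(y) = β_L^{(-)}(y)`, hence `f̃_{i_L}(y) = 0` and `φ_{i_L}(y) = 0`,
so that `f̃_{i_L}^{max}(y) = f̃_{i_L}^{φ_{i_L}(y)}(y) = y`. -/
theorem ftil_max_of_beta_nonneg {I : Type*} [Fintype I] [DecidableEq I]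
    (A : I → I → ℤ)
    (hAdiag : ∀ i, A i i = 2)
    (hAoff : ∀ i j, i ≠ j → A i j ≤ 0)
    (hAzero : ∀ i j, A i j = 0 ↔ A j i = 0)
    (hAsym : ∃ d : I → ℤ, (∀ i, 0 < d i) ∧ ∀ i j, d i * A i j = d j * A j i)
    (ι : ℕ → I)
    (hι₁ : ∀ k, 1 ≤ k → ι k ≠ ι (k + 1))
    (hι₂ : ∀ i : I, {k : ℕ | 1 ≤ k ∧ ι k = i}.Infinite)
    (lam : I → ℤ) (hlam : ∀ i, 0 ≤ lam i)
    (L : ℕ) (hL : 1 ≤ L)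
    (y : ℕ →₀ ℤ) (hy0 : y 0 = 0) (hyL : ∀ k, L ≤ k → y k = 0)
    (hbeta : ∀ j, 1 ≤ j → j ≤ L - 1 → betaME A ι lam j y = 0)
    (hnonneg : 0 ≤ betaME A ι lam L y) :
    sigMax A ι (ι L) y = betaME A ι lam L y ∧
    sig0 A ι lam (ι L) y = betaME A ι lam L y ∧
    ftil A ι lam (ι L) (some y) = none ∧
    phi A ι lam (ι L) y = 0 ∧
    (ftil A ι lam (ι L))^[(phi A ι lam (ι L) y).toNat] (some y) = some y := by
  have hdef : ∀ j, 1 ≤ j → j < L → defect A ι lam j y = 0 := fun _ h1 h2 =>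
    defect_eq_zero hAdiag hbeta h1 h2
  rw [betaME_eq_defect hAdiag hbeta] at hnonneg ⊢
  have hmax := sigMax_eq_defect hAdiag hAoff hAzero hlam hL hyL hdef hnonneg
  have hsig0 : sig0 A ι lam (ι L) y = defect A ι lam L y := sig0_eq_defect hyL
  have hphi : phi A ι lam (ι L) y = 0 := by rw [phi, eps, hmax, hsig0, max_self, sub_self]
  refine ⟨hmax, hsig0, ?_, hphi, ?_⟩
  · rw [ftil, hmax, hsig0, if_neg (lt_irrefl _)]
  · rw [hphi]
    rfl

end PaperNakashima
end
end

section
/- In the rank 2 setting, suppose L ≥ 1 is such that the alternating word w_L (equal to s_1(s_2s_1)^l if L = 2l+1 and (s_2s_1)^l if L = 2l) is reduced in the Weyl group W of A. Define f̃_i^{max}(x) = f̃_i^{φ_i(x)}(x). Then f̃_{i_L}^{max} f̃_{i_{L−1}}^{max} ⋯ f̃_{i_1}^{max}(0̄) = (…, 0, 0, d_L, d_{L−1}, …, d_2, d_1), where d_k = m_1·a_k(c_2, c_1) + m_2·a_{k−1}(c_1, c_2). (This is the image of the extremal vector u_{w_L λ} ∈ B(λ) under the Kashiwara embedding.) -/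
noncomputable section

namespace PaperNakashima

variable {I : Type*} [DecidableEq I]

/-- `f̃_i^{max}(x) = f̃_i^{φ_i(x)}(x)`. -/
def ftilMax (A : I → I → ℤ) (ι : ℕ → I) (lam : I → ℤ) (i : I) :
    Option (ℕ →₀ ℤ) → Option (ℕ →₀ ℤ)
  | none => none
  | some x => (ftil A ι lam i)^[(phi A ι lam i x).toNat] (some x)

/-- The sequences `d` satisfying the recurrence of the extremal vectors for the alternating
sequence `ι = (…,2,1,2,1)` and the weight `lam`. -/
structure IsExtremalSequence (A : Fin 2 → Fin 2 → ℤ) (ι : ℕ → Fin 2) (lam : Fin 2 → ℤ)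
    (d : ℕ → ℤ) : Prop where
  diag : ∀ i, A i i = 2
  parity : ∀ k, ι k = if k % 2 = 1 then (0 : Fin 2) else 1
  one : d 1 = lam 0
  two : d 2 = lam 1 - A 1 0 * d 1
  succ_succ : ∀ k, 1 ≤ k → d (k + 2) = -A (ι k) (ι (k + 1)) * d (k + 1) - d k

/-- The point `(…, 0, 0, n, d_L, …, d_1)`. -/
def truncatedPoint (d : ℕ → ℤ) (L : ℕ) (n : ℤ) : ℕ →₀ ℤ :=
  ∑ k ∈ Finset.Icc 1 L, Finsupp.single k (d k) + Finsupp.single (L + 1) n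

lemma truncatedPoint_apply (d : ℕ → ℤ) (L : ℕ) (n : ℤ) (j : ℕ) :
    truncatedPoint d L n j =
      if 1 ≤ j ∧ j ≤ L then d j else if j = L + 1 then n else 0 := by
  simp only [truncatedPoint, Finsupp.add_apply, Finsupp.finsetSum_apply, Finsupp.single_apply,
    Finset.sum_ite_eq', Finset.mem_Icc]
  grind

lemma truncatedPoint_self (d : ℕ → ℤ) (L : ℕ) :
    truncatedPoint d L (d (L + 1)) =
      ∑ k ∈ Finset.Icc 1 (L + 1), Finsupp.single k (d k) := by
  rw [truncatedPoint, Finset.sum_Icc_succ_top (by omega)]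

lemma truncatedPoint_zero (d : ℕ → ℤ) (L : ℕ) :
    truncatedPoint d L 0 = ∑ k ∈ Finset.Icc 1 L, Finsupp.single k (d k) := by
  simp [truncatedPoint]

lemma truncatedPoint_add_single (d : ℕ → ℤ) (L : ℕ) (n : ℤ) :
    truncatedPoint d L n + Finsupp.single (L + 1) 1 = truncatedPoint d L (n + 1) := by
  rw [truncatedPoint, truncatedPoint, add_assoc, ← Finsupp.single_add]

lemma sum_support_filter_eq_s17 {x : ℕ →₀ ℤ} {N : ℕ} (hx : ∀ j, N < j → x j = 0) (b : ℕ → ℤ) (k : ℕ) :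
    ∑ j ∈ x.support.filter (fun j => k < j), b j * x j = ∑ j ∈ Finset.Ioc k N, b j * x j := by
  apply Finset.sum_subset
  · intro j hj
    simp only [Finset.mem_filter, Finsupp.mem_support_iff] at hj
    exact Finset.mem_Ioc.2 ⟨hj.2, not_lt.1 fun h => hj.1 (hx j h)⟩
  · intro j hj hj'
    simp only [Finset.mem_filter, Finsupp.mem_support_iff, Finset.mem_Ioc] at hj hj'
    have : x j = 0 := by tauto
    simp [this]

lemma sig_truncatedPoint (A : Fin 2 → Fin 2 → ℤ) (ι : ℕ → Fin 2) (d : ℕ → ℤ) (L : ℕ)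
    (n : ℤ) (k : ℕ) :
    sig A ι k (truncatedPoint d L n) = truncatedPoint d L n k +
      ∑ j ∈ Finset.Ioc k (L + 1), A (ι k) (ι j) * truncatedPoint d L n j := by
  rw [sig, sum_support_filter_eq_s17 (N := L + 1)]
  intro j hj
  rw [truncatedPoint_apply, if_neg (by omega), if_neg (by omega)]

lemma sig_truncatedPoint_succ (A : Fin 2 → Fin 2 → ℤ) (ι : ℕ → Fin 2) (d : ℕ → ℤ) (L : ℕ)
    (n : ℤ) :
    sig A ι (L + 1) (truncatedPoint d L n) = n := by
  simp [sig_truncatedPoint, truncatedPoint_apply]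

lemma sig_truncatedPoint_of_lt (A : Fin 2 → Fin 2 → ℤ) (ι : ℕ → Fin 2) (d : ℕ → ℤ) {L k : ℕ}
    (n : ℤ) (hk : L + 1 < k) :
    sig A ι k (truncatedPoint d L n) = 0 := by
  rw [sig_truncatedPoint, Finset.Ioc_eq_empty (by omega), truncatedPoint_apply,
    if_neg (by omega), if_neg (by omega), Finset.sum_empty, add_zero]

namespace IsExtremalSequence

variable {A : Fin 2 → Fin 2 → ℤ} {ι : ℕ → Fin 2} {lam : Fin 2 → ℤ} {d : ℕ → ℤ}

lemma eq_iff (h : IsExtremalSequence A ι lam d) (k l : ℕ) : ι k = ι l ↔ k % 2 = l % 2 := by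
  rw [h.parity, h.parity]
  rcases Nat.mod_two_eq_zero_or_one k with hk | hk <;>
    rcases Nat.mod_two_eq_zero_or_one l with hl | hl <;> simp [hk, hl]

/-- The weighted tail sums `d_k + Σ_{j>k} a_{i_{L+1} i_j} x_j` of `truncatedPoint` do not depend on
`k` as long as `k < L + 1` has the parity of `L + 1`. -/
lemma add_tail_eq (h : IsExtremalSequence A ι lam d) (n : ℤ) (t : ℕ) :
    ∀ k L, 1 ≤ k → k + 2 * t + 1 = L →
      d k + ∑ j ∈ Finset.Ioc k (L + 1), A (ι (L + 1)) (ι j) * truncatedPoint d L n j =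
        2 * n - d (L + 1) := by
  induction t with
  | zero =>
    rintro k L hk rfl
    have e : Finset.Ioc k (k + 2 * 0 + 1 + 1) = {k + 1, k + 2} := by ext; simp; omega
    have hι : ι (k + 2) = ι k := (h.eq_iff _ _).2 (by omega)
    rw [e, Finset.sum_pair (by omega)]
    simp only [truncatedPoint_apply]
    simp [h.succ_succ k hk, hι, h.diag]
    ring
  | succ t ih =>
    rintro k L hk hL
    have hι : ι (L + 1) = ι k := (h.eq_iff _ _).2 (by omega)
    have hι' : ι (k + 2) = ι k := (h.eq_iff _ _).2 (by omega)
    have key := ih (k + 2) L (by omega) (by omega)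
    rw [← Finset.insert_Ioc_succ_left_eq_Ioc (show k < L + 1 by omega),
      Finset.sum_insert (by simp), Order.succ_eq_add_one,
      ← Finset.insert_Ioc_succ_left_eq_Ioc (show k + 1 < L + 1 by omega),
      Finset.sum_insert (by simp), Order.succ_eq_add_one, ← key]
    simp only [truncatedPoint_apply d L n (k + 1), truncatedPoint_apply d L n (k + 1 + 1)]
    rw [if_pos (by omega), if_pos (by omega), hι, show k + 1 + 1 = k + 2 from rfl, hι', h.diag,
      h.succ_succ k hk]
    ring

lemma sig_of_le (h : IsExtremalSequence A ι lam d) {L k : ℕ} (n : ℤ) (hk : 1 ≤ k) (hkL : k ≤ L)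
    (hι : ι k = ι (L + 1)) :
    sig A ι k (truncatedPoint d L n) = 2 * n - d (L + 1) := by
  have hmod := (h.eq_iff _ _).1 hι
  rw [sig_truncatedPoint, hι, ← h.add_tail_eq n ((L - 1 - k) / 2) k L hk (by omega),
    truncatedPoint_apply d L n k, if_pos ⟨hk, hkL⟩]

lemma sig0_truncatedPoint (h : IsExtremalSequence A ι lam d) (L : ℕ) (n : ℤ) :
    sig0 A ι lam (ι (L + 1)) (truncatedPoint d L n) = 2 * n - d (L + 1) := by
  have e : sig0 A ι lam (ι (L + 1)) (truncatedPoint d L n) = -lam (ι (L + 1)) +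
      ∑ j ∈ Finset.Ioc 0 (L + 1), A (ι (L + 1)) (ι j) * truncatedPoint d L n j := by
    rw [sig0, ← sum_support_filter_eq_s17 (N := L + 1)]
    · rfl
    · intro j hj
      rw [truncatedPoint_apply, if_neg (by omega), if_neg (by omega)]
  have ι_one : ι 1 = 0 := by simp [h.parity]
  have ι_two : ι 2 = 1 := by simp [h.parity]
  rw [e, ← Finset.insert_Ioc_succ_left_eq_Ioc (show 0 < L + 1 by omega),
    Finset.sum_insert (by simp), Order.succ_eq_add_one, zero_add]
  obtain hL | hL := Nat.mod_two_eq_zero_or_one L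
  · have hι : ι (L + 1) = ι 1 := (h.eq_iff _ _).2 (by omega)
    rcases Nat.eq_zero_or_pos L with rfl | hpos
    · simp [truncatedPoint_apply, h.diag, ι_one, h.one]
      ring
    · rw [← h.add_tail_eq n ((L - 2) / 2) 1 L le_rfl (by omega), hι, h.diag,
        truncatedPoint_apply d L n 1, if_pos ⟨le_rfl, hpos⟩, h.one, ι_one]
      ring
  · have hι : ι (L + 1) = ι 2 := (h.eq_iff _ _).2 (by omega)
    rw [← Finset.insert_Ioc_succ_left_eq_Ioc (show 1 < L + 1 by omega),
      Finset.sum_insert (by simp), Order.succ_eq_add_one, one_add_one_eq_two]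
    rcases Nat.lt_or_ge L 2 with hlt | hge
    · obtain rfl : L = 1 := by omega
      simp [truncatedPoint_apply, h.diag, ι_one, ι_two, h.two]
      ring
    · rw [← h.add_tail_eq n ((L - 3) / 2) 2 L (by omega) (by omega), hι, h.diag,
        truncatedPoint_apply d L n 1, truncatedPoint_apply d L n 2, if_pos (by omega),
        if_pos (by omega), h.two, ι_one, ι_two]
      ring

lemma sigMax_truncatedPoint (h : IsExtremalSequence A ι lam d) {L : ℕ} {n : ℤ} (hn : 0 ≤ n)
    (hnd : n ≤ d (L + 1)) :
    sigMax A ι (ι (L + 1)) (truncatedPoint d L n) = n := by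
  refine IsGreatest.csSup_eq ⟨⟨L + 1, ⟨by omega, rfl⟩, sig_truncatedPoint_succ A ι d L n⟩, ?_⟩
  rintro _ ⟨k, ⟨hk, hι⟩, rfl⟩
  rcases lt_trichotomy k (L + 1) with hlt | rfl | hgt
  · simp only [h.sig_of_le n hk (by omega) hι]
    omega
  · exact (sig_truncatedPoint_succ A ι d L n).le
  · simpa only [sig_truncatedPoint_of_lt A ι d n hgt]

lemma sInf_Mset_truncatedPoint (h : IsExtremalSequence A ι lam d) {L : ℕ} {n : ℤ} (hn : 0 ≤ n)
    (hnd : n < d (L + 1)) :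
    sInf (Mset A ι (ι (L + 1)) (truncatedPoint d L n)) = L + 1 := by
  have hmax := h.sigMax_truncatedPoint hn hnd.le
  refine IsLeast.csInf_eq ⟨⟨by omega, rfl, by rw [hmax, sig_truncatedPoint_succ]⟩, ?_⟩
  rintro k ⟨hk, hι, hsig⟩
  by_contra hlt
  rw [hmax, h.sig_of_le n hk (by omega) hι] at hsig
  omega

lemma ftil_truncatedPoint (h : IsExtremalSequence A ι lam d) {L : ℕ} {n : ℤ} (hn : 0 ≤ n)
    (hnd : n < d (L + 1)) :
    ftil A ι lam (ι (L + 1)) (some (truncatedPoint d L n)) =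
      some (truncatedPoint d L (n + 1)) := by
  rw [ftil, h.sig0_truncatedPoint, h.sigMax_truncatedPoint hn hnd.le, if_pos (by omega),
    h.sInf_Mset_truncatedPoint hn hnd, truncatedPoint_add_single]

lemma ftil_iterate (h : IsExtremalSequence A ι lam d) {L : ℕ} (n : ℕ)
    (hnd : (n : ℤ) ≤ d (L + 1)) :
    (ftil A ι lam (ι (L + 1)))^[n] (some (truncatedPoint d L 0)) =
      some (truncatedPoint d L n) := by
  induction n with
  | zero => simp
  | succ n ih =>
    push_cast at hnd
    rw [Function.iterate_succ_apply', ih (by omega),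
      h.ftil_truncatedPoint (by omega) (by omega), Nat.cast_succ]

lemma ftilMax_truncatedPoint (h : IsExtremalSequence A ι lam d) {L : ℕ} (hd : 0 ≤ d (L + 1)) :
    ftilMax A ι lam (ι (L + 1)) (some (truncatedPoint d L 0)) =
      some (truncatedPoint d L (d (L + 1))) := by
  have hphi : phi A ι lam (ι (L + 1)) (truncatedPoint d L 0) = d (L + 1) := by
    rw [phi, eps, h.sig0_truncatedPoint, h.sigMax_truncatedPoint le_rfl hd]
    omega
  rw [ftilMax, hphi, h.ftil_iterate _ (Int.toNat_of_nonneg hd).le, Int.toNat_of_nonneg hd]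

theorem foldl_ftilMax (h : IsExtremalSequence A ι lam d) (L : ℕ)
    (hd : ∀ k, 1 ≤ k → k ≤ L → 0 ≤ d k) :
    List.foldl (fun y k => ftilMax A ι lam (ι k) y) (some 0) (List.range' 1 L) =
      some (∑ k ∈ Finset.Icc 1 L, Finsupp.single k (d k)) := by
  induction L with
  | zero => simp
  | succ L ih =>
    rw [List.range'_1_concat, List.foldl_append, ih fun k hk hkL => hd k hk (by omega),
      ← truncatedPoint_self, ← truncatedPoint_zero]
    simpa [add_comm 1 L] using h.ftilMax_truncatedPoint (hd (L + 1) (by omega) le_rfl)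

end IsExtremalSequence

lemma demWord_eq_alternatingWord {ι : ℕ → Fin 2}
    (hι : ∀ k, ι k = if k % 2 = 1 then (0 : Fin 2) else 1) (L : ℕ) :
    demWord ι L = CoxeterSystem.alternatingWord 1 0 L := by
  induction L with
  | zero => rfl
  | succ L ih =>
    rw [CoxeterSystem.alternatingWord_succ', ← ih, demWord, List.range_succ_eq_map, List.map_cons,
      List.map_map, hι]
    congr 1
    · simp only [Nat.even_iff]
      split_ifs <;> first | rfl | omega
    · simp [demWord, Function.comp_def]

/-- The recurrence satisfied by the sequence `a_l(c, c')`. -/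
lemma chebyshev_sequence_rec {c c' : ℤ} {p a : ℕ → ℤ} (hp0 : p 0 = 1) (hp1 : p 1 = c * c' - 2)
    (hp : ∀ k, p (k + 2) = (c * c' - 2) * p (k + 1) - p k)
    (ha0 : a 0 = 0) (ha1 : a 1 = 1) (heven : ∀ k, 1 ≤ k → a (2 * k) = c * p (k - 1))
    (hodd : ∀ k, 1 ≤ k → a (2 * k + 1) = p k + p (k - 1)) (k : ℕ) :
    a (k + 2) = (if k % 2 = 0 then c else c') * a (k + 1) - a k := by
  obtain ⟨l, rfl | rfl⟩ := Nat.even_or_odd' k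
  · have h2 := heven (l + 1) (by omega)
    rw [if_pos (by omega), show 2 * l + 2 = 2 * (l + 1) by ring, h2]
    rcases l with _ | l
    · simp [ha0, ha1, hp0]
    · rw [hodd _ (by omega), heven _ (by omega), Nat.add_sub_cancel, Nat.add_sub_cancel]
      ring
  · have h2 := heven (l + 1) (by omega)
    rw [if_neg (by omega), show 2 * l + 1 + 1 = 2 * (l + 1) by ring,
      show 2 * l + 1 + 2 = 2 * (l + 1) + 1 by ring, hodd _ (by omega), h2]
    rcases l with _ | l
    · simp [ha1, hp0, hp1]
      ring
    · rw [hodd _ (by omega), Nat.add_sub_cancel, Nat.add_sub_cancel, hp]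
      ring

lemma chebyshev_nonneg_mono {X : ℤ} (hX : 2 ≤ X) {p : ℕ → ℤ} (hp0 : p 0 = 1) (hp1 : p 1 = X)
    (hp : ∀ k, p (k + 2) = X * p (k + 1) - p k) (k : ℕ) : 0 ≤ p k ∧ p k ≤ p (k + 1) := by
  induction k with
  | zero => rw [hp0, hp1]; omega
  | succ k ih => exact ⟨ih.1.trans ih.2, by rw [hp]; nlinarith [ih.1, ih.2]⟩

/-- The sequence `a_l(c, c')` is nonnegative up to the braid exponent `m`. -/
lemma chebyshev_sequence_nonneg {c c' : ℤ} (hc : (c = 0 ∧ c' = 0) ∨ (0 < c ∧ 0 < c'))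
    {p a : ℕ → ℤ} (hp0 : p 0 = 1) (hp1 : p 1 = c * c' - 2)
    (hp : ∀ k, p (k + 2) = (c * c' - 2) * p (k + 1) - p k)
    (ha0 : a 0 = 0) (ha1 : a 1 = 1) (heven : ∀ k, 1 ≤ k → a (2 * k) = c * p (k - 1))
    (hodd : ∀ k, 1 ≤ k → a (2 * k + 1) = p k + p (k - 1)) {m k : ℕ}
    (hm : m = if c * c' = 0 then 2 else if c * c' = 1 then 3 else if c * c' = 2 then 4
      else if c * c' = 3 then 6 else 0)
    (hk : m ≠ 0 → k ≤ m) : 0 ≤ a k := by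
  have hc0 : 0 ≤ c := by omega
  have a2 : a 2 = c * p 0 := heven 1 le_rfl
  have a3 : a 3 = p 1 + p 0 := hodd 1 le_rfl
  have a4 : a 4 = c * p 1 := heven 2 (by omega)
  have a5 : a 5 = p 2 + p 1 := hodd 2 (by omega)
  have a6 : a 6 = c * p 2 := heven 3 (by omega)
  have p2 : p 2 = (c * c' - 2) * p 1 - p 0 := hp 0
  split_ifs at hm with h0 h1 h2 h3
  · have : k ≤ 2 := by omega
    interval_cases k <;> simp_all
  · have : k ≤ 3 := by omega
    interval_cases k <;> simp_all
  · have : k ≤ 4 := by omega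
    interval_cases k <;> simp_all
  · have : k ≤ 6 := by omega
    interval_cases k <;> simp_all
  · have hcc : 0 ≤ c * c' := by
      rcases hc with ⟨rfl, rfl⟩ | ⟨h, h'⟩ <;> positivity
    have hX : 2 ≤ c * c' - 2 := by omega
    have hpos k := (chebyshev_nonneg_mono hX hp0 hp1 hp k).1
    obtain ⟨l, rfl | rfl⟩ := Nat.even_or_odd' k
    · rcases l with _ | l
      · simp [ha0]
      · rw [heven _ (by omega)]
        exact mul_nonneg hc0 (hpos _)
    · rcases l with _ | l
      · simp [ha1]
      · rw [hodd _ (by omega)]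
        exact add_nonneg (hpos _) (hpos _)

/-- Rank 2 case: for the alternating sequence `ι = (…,2,1,2,1)` and the
Cartan matrix `⟨2, −c₁; −c₂, 2⟩`, if the alternating word `w_L = s_{i_L}⋯s_{i_1}` is reduced,
then the image of the extremal vector `u_{w_L λ}` is
`f̃_{i_L}^{max} ⋯ f̃_{i_1}^{max}(0̄) = (…, 0, 0, d_L, …, d_2, d_1)`, where
`d_k = m₁·a_k(c₂,c₁) + m₂·a_{k−1}(c₁,c₂)`. -/
theorem rank_two_extremal_vector
    (c₁ c₂ : ℤ) (hc : (c₁ = 0 ∧ c₂ = 0) ∨ (0 < c₁ ∧ 0 < c₂))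
    (A : Fin 2 → Fin 2 → ℤ)
    (hA00 : A 0 0 = 2) (hA11 : A 1 1 = 2) (hA01 : A 0 1 = -c₁) (hA10 : A 1 0 = -c₂)
    (ι : ℕ → Fin 2) (hι : ∀ k, ι k = if k % 2 = 1 then (0 : Fin 2) else 1)
    (m₁ m₂ : ℤ) (hm₁ : 0 ≤ m₁) (hm₂ : 0 ≤ m₂)
    (lam : Fin 2 → ℤ) (hlam0 : lam 0 = m₁) (hlam1 : lam 1 = m₂)
    (P : ℕ → Polynomial ℤ)
    (hP0 : P 0 = 1) (hP1 : P 1 = Polynomial.X)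
    (hPrec : ∀ k, 1 ≤ k → P (k + 1) = Polynomial.X * P k - P (k - 1))
    (a : ℕ → ℤ) (ha0 : a 0 = 0) (ha1 : a 1 = 1)
    (haeven : ∀ k, 1 ≤ k → a (2 * k) = c₁ * (P (k - 1)).eval (c₁ * c₂ - 2))
    (haodd : ∀ k, 1 ≤ k →
      a (2 * k + 1) = (P k).eval (c₁ * c₂ - 2) + (P (k - 1)).eval (c₁ * c₂ - 2))
    (a' : ℕ → ℤ) (ha'0 : a' 0 = 0) (ha'1 : a' 1 = 1)
    (ha'even : ∀ k, 1 ≤ k → a' (2 * k) = c₂ * (P (k - 1)).eval (c₂ * c₁ - 2))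
    (ha'odd : ∀ k, 1 ≤ k →
      a' (2 * k + 1) = (P k).eval (c₂ * c₁ - 2) + (P (k - 1)).eval (c₂ * c₁ - 2))
    (L : ℕ) (hL : 1 ≤ L)
    (hred : (coxOf A).toCoxeterSystem.IsReduced (demWord ι L)) :
    List.foldl (fun y k => ftilMax A ι lam (ι k) y) (some 0) (List.range' 1 L) =
      some (∑ k ∈ Finset.Icc 1 L,
        Finsupp.single k (m₁ * a' k + m₂ * a (k - 1))) := by
  have hX : c₂ * c₁ - 2 = c₁ * c₂ - 2 := by ring
  rw [hX] at ha'even ha'odd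
  have hp0 : (P 0).eval (c₁ * c₂ - 2) = 1 := by simp [hP0]
  have hp1 : (P 1).eval (c₁ * c₂ - 2) = c₁ * c₂ - 2 := by simp [hP1]
  have hp k : (P (k + 2)).eval (c₁ * c₂ - 2) =
      (c₁ * c₂ - 2) * (P (k + 1)).eval (c₁ * c₂ - 2) - (P k).eval (c₁ * c₂ - 2) := by
    simp [hPrec (k + 1)]
  have hrec := chebyshev_sequence_rec (p := fun k => (P k).eval (c₁ * c₂ - 2))
    hp0 hp1 hp ha0 ha1 haeven haodd
  have hrec' := chebyshev_sequence_rec (p := fun k => (P k).eval (c₁ * c₂ - 2))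
    (c := c₂) (c' := c₁) hp0 (by rw [hX]; exact hp1) (by rw [hX]; exact hp)
    ha'0 ha'1 ha'even ha'odd
  have h : IsExtremalSequence A ι lam fun k => m₁ * a' k + m₂ * a (k - 1) := by
    refine ⟨fun i => ?_, hι, by simp [ha0, ha'1, hlam0], ?_, fun k hk => ?_⟩
    · fin_cases i <;> assumption
    · have := hrec' 0
      simp only [ha0, ha1, ha'0, ha'1, hlam1, hA10] at this ⊢
      simp at this ⊢
      rw [this]
      ring
    · obtain ⟨k, rfl⟩ := Nat.exists_eq_add_of_le' hk
      simp only [show k + 1 + 2 - 1 = k + 2 by omega, Nat.add_sub_cancel]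
      rw [hrec', hrec, hι, hι]
      obtain hk | hk := Nat.mod_two_eq_zero_or_one k
      · rw [if_neg (by omega), if_pos hk, if_pos (by omega), if_neg (by omega), hA01]
        ring
      · rw [if_pos (by omega), if_neg (by omega), if_neg (by omega), if_pos (by omega), hA10]
        ring
  set m := coxEntry A 1 0 with hm
  have hm' : m = if c₁ * c₂ = 0 then 2 else if c₁ * c₂ = 1 then 3 else if c₁ * c₂ = 2 then 4
      else if c₁ * c₂ = 3 then 6 else 0 := by
    simp only [hm, coxEntry, hA10, hA01, neg_mul_neg, mul_comm c₂ c₁, one_ne_zero, if_false]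
  have hLm : m ≠ 0 → L ≤ m := fun hm0 => by
    by_contra! hlt
    rw [demWord_eq_alternatingWord hι] at hred
    exact (coxOf A).toCoxeterSystem.not_isReduced_alternatingWord 1 0 hm0 hlt hred
  refine h.foldl_ftilMax L fun k hk hkL => add_nonneg (mul_nonneg hm₁ ?_) (mul_nonneg hm₂ ?_)
  · exact chebyshev_sequence_nonneg (p := fun k => (P k).eval (c₁ * c₂ - 2))
      (c := c₂) (c' := c₁) (m := m) (by tauto) hp0 (by rw [hX]; exact hp1) (by rw [hX]; exact hp)
      ha'0 ha'1 ha'even ha'odd (by rw [mul_comm c₂ c₁]; exact hm') (by omega)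
  · exact chebyshev_sequence_nonneg (p := fun k => (P k).eval (c₁ * c₂ - 2))
      hc hp0 hp1 hp ha0 ha1 haeven haodd hm' (by omega)

end PaperNakashima
end
end
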